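/- arXiv:1310.7716 — 2 statements merged into one kernel-verified Lean document; each statement's English description precedes it below -/
import Mathlib

section
/- Let r ≥ 1, χ : {1,…,r} → {0,1}, A ∈ GL_r(ℝ) with A* = (Aᵀ)^{−1} = (a*_{μν}), x ∈ (0,1)^r, and s ∈ ℂ^r with Re s_ν > 1 for every ν. Define R_χ(s, A, x, y) = e(x·y) L_χ(s, A, x, y). Then for each ν ∈ {1,…,r}, the function y ↦ R_χ(s, A, x, y) on (0,1)^r is differentiable in y_ν and ∂/∂y_ν R_χ(s, A, x, y) = 2πi Σ_{μ=1}^r a*_{μν} R_{χ+1_μ}(s−1_μ, A, x, y), where χ+1_μ is the parity type obtained from χ by flipping its value at μ (mod 2), and s−1_μ subtracts 1 from the μ-th coordinate of s. -/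
open MeasureTheory

noncomputable section

/-- `e z = exp (2 π i z)` -/
def eC (z : ℂ) : ℂ := Complex.exp (2 * Real.pi * Complex.I * z)

/-- `φ(t,x,y) = e(itx)/(1 - e(y + it))` -/
def phiF (t x y : ℝ) : ℂ := eC (Complex.I * t * x) / (1 - eC (y + Complex.I * t))

/-- `F(t,x,y) = ∏_ν φ(t_ν, x_ν, y_ν)` -/
def FF {r : ℕ} (t x y : Fin r → ℝ) : ℂ := ∏ ν, phiF (t ν) (x ν) (y ν)

/-- `Γ_ℝ(s) = π^(-s/2) Γ(s/2)` -/
def GammaR (s : ℂ) : ℂ := (Real.pi : ℂ) ^ (-s / 2) * Complex.Gamma (s / 2)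

/-- `Γ_ℂ(s) = 2 (2π)^(-s) Γ(s)` -/
def GammaC (s : ℂ) : ℂ := 2 * (2 * (Real.pi : ℂ)) ^ (-s) * Complex.Gamma s

/-- the quasi-character `|t|_χ^s = ∏_ν sgn(t_ν)^{χ(ν)} |t_ν|^{s_ν}` -/
def qchar {r : ℕ} (χ : Fin r → ℕ) (s : Fin r → ℂ) (t : Fin r → ℝ) : ℂ :=
  ∏ ν, ((Real.sign (t ν) : ℂ)) ^ (χ ν) * ((|t ν| : ℝ) : ℂ) ^ (s ν)

/-- the Shintani L-function, defined by the integral representation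
`L(s,A,x,y) = 2^r (∏ Γ_ℂ(s_ν))⁻¹ ∫_{(0,∞)^r} F(tA,x,y) t^s ∏ dt_ν/t_ν` -/
def ShintaniL {r : ℕ} (s : Fin r → ℂ) (A : Matrix (Fin r) (Fin r) ℝ)
    (x y : Fin r → ℝ) : ℂ :=
  2 ^ r * (∏ ν, GammaC (s ν))⁻¹ *
    ∫ t in Set.univ.pi fun _ : Fin r => Set.Ioi (0 : ℝ),
      FF (Matrix.vecMul t A) x y * ∏ ν, (((t ν : ℝ) : ℂ) ^ (s ν) * ((t ν : ℝ) : ℂ)⁻¹)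

/-- the normalized Shintani L-function of parity type χ,
`L_χ(s,A,x,y) = (∏ Γ_ℂ(s_ν))⁻¹ ∫_{(ℝ^×)^r} F(tA,x,y) |t|_χ^s ∏ dt_ν/t_ν` -/
def ShintaniLchi {r : ℕ} (χ : Fin r → ℕ) (s : Fin r → ℂ)
    (A : Matrix (Fin r) (Fin r) ℝ) (x y : Fin r → ℝ) : ℂ :=
  (∏ ν, GammaC (s ν))⁻¹ *
    ∫ t : Fin r → ℝ,
      FF (Matrix.vecMul t A) x y * qchar χ s t * ∏ ν, ((t ν : ℝ) : ℂ)⁻¹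

/-- `Γ_χ(s) = ∏_ν Γ_ℝ(s_ν + χ(ν))` -/
def GammaChi {r : ℕ} (χ : Fin r → ℕ) (s : Fin r → ℂ) : ℂ :=
  ∏ ν, GammaR (s ν + (χ ν : ℂ))

/-- the completed normalized Shintani L-function
`L̂_χ(s,A,x,y) = |det A|^{1/2} Γ_χ(s) L_χ(s,A,x,y)` -/
def ShintaniLhat {r : ℕ} (χ : Fin r → ℕ) (s : Fin r → ℂ)
    (A : Matrix (Fin r) (Fin r) ℝ) (x y : Fin r → ℝ) : ℂ :=
  ((Real.sqrt |A.det| : ℝ) : ℂ) * GammaChi χ s * ShintaniLchi χ s A x y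


/-- `R_χ(s,A,x,y) = e(x·y) L_χ(s,A,x,y)` -/
def RChi {r : ℕ} (χ : Fin r → ℕ) (s : Fin r → ℂ)
    (A : Matrix (Fin r) (Fin r) ℝ) (x y : Fin r → ℝ) : ℂ :=
  eC ((∑ ν, x ν * y ν : ℝ) : ℂ) * ShintaniLchi χ s A x y


lemma ibp_aux1 (f f' : ℝ → ℂ) (hf : Integrable f) (hf' : Integrable f') (hc : Continuous f)
    (hd : ∀ u, u ≠ 0 → HasDerivAt f (f' u) u) : ∫ u, f' u = 0 := by
  have h1 : ∫ u in Set.Ioi 0, f' u = 0 - f 0 :=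
    integral_Ioi_of_hasDerivAt_of_tendsto hc.continuousWithinAt
      (fun u hu => hd u (ne_of_gt hu)) hf'.integrableOn
      (tendsto_zero_of_hasDerivAt_of_integrableOn_Ioi (a := 0)
        (fun u hu => hd u (ne_of_gt hu)) hf'.integrableOn hf.integrableOn)
  have h2 : ∫ u in Set.Iic 0, f' u = f 0 - 0 :=
    integral_Iic_of_hasDerivAt_of_tendsto hc.continuousWithinAt
      (fun u hu => hd u (ne_of_lt hu)) hf'.integrableOn
      (tendsto_zero_of_hasDerivAt_of_integrableOn_Iic (a := -1)
        (fun u hu => hd u (by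
          have : u ≤ -1 := hu
          intro h; linarith)) hf'.integrableOn hf.integrableOn)
  have h3 := intervalIntegral.integral_Iic_add_Ioi (f := f') (b := (0:ℝ)) (μ := volume)
    hf'.integrableOn hf'.integrableOn
  rw [← h3, h1, h2]; ring

lemma ibp_aux {r : ℕ} (f f' : (Fin r → ℝ) → ℂ) (μ : Fin r) (hf : Integrable f)
    (hf' : Integrable f')
    (hc : ∀ t, Continuous fun u => f (Function.update t μ u))
    (hd : ∀ t, t μ ≠ 0 → HasDerivAt (fun u => f (Function.update t μ u)) (f' t) (t μ)) :
    ∫ t, f' t = 0 := by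
  obtain _ | n := r
  · exact μ.elim0
  have hv := volume_preserving_piFinSuccAbove (fun _ : Fin (n+1) => ℝ) μ
  have hvs := hv.symm
  have key := hvs.integral_comp' (g := f')
  rw [← key]
  have hfi := (hvs.integrable_comp_emb (MeasurableEquiv.measurableEmbedding _) (g := f)).2 hf
  have hfi' := (hvs.integrable_comp_emb (MeasurableEquiv.measurableEmbedding _) (g := f')).2 hf'
  rw [Measure.volume_eq_prod] at hfi hfi' ⊢
  change ∫ x, (f' ∘ (MeasurableEquiv.piFinSuccAbove (fun _ : Fin (n+1) => ℝ) μ).symm) x ∂_ = 0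
  rw [integral_prod_symm _ hfi']
  apply integral_eq_zero_of_ae
  filter_upwards [hfi.prod_left_ae, hfi'.prod_left_ae] with t' h1 h2
  refine ibp_aux1 _ _ h1 h2 ?_ ?_
  · have := hc (μ.insertNth (0:ℝ) t')
    simp only [Fin.update_insertNth] at this
    exact this
  · intro u hu
    have := hd (μ.insertNth u t') (by simpa using hu)
    simp only [Fin.update_insertNth, Fin.insertNth_apply_same] at this
    exact this

/-- one-dimensional kernel -/
def kk (χ : ℕ) (s : ℂ) (u : ℝ) : ℂ :=
  (Real.sign u : ℂ) ^ χ * ((|u| : ℝ) : ℂ) ^ s * ((u : ℝ) : ℂ)⁻¹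

lemma kk_norm_le (χ : ℕ) (s : ℂ) (u : ℝ) : ‖kk χ s u‖ ≤ |u| ^ (s.re - 1) := by
  by_cases hu : u = 0
  · subst hu
    simp only [kk, Complex.ofReal_zero, inv_zero, mul_zero, norm_zero]
    positivity
  have hp : 0 < |u| := abs_pos.2 hu
  have h1 : ‖(Real.sign u : ℂ)‖ = 1 := by
    rcases Real.sign_apply_eq_of_ne_zero u hu with h | h <;> simp [h]
  rw [kk, norm_mul, norm_mul, norm_pow, h1, Complex.norm_cpow_eq_rpow_re_of_pos hp,
    Real.rpow_sub hp, Real.rpow_one, norm_inv, Complex.norm_real, Real.norm_eq_abs]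
  simp [div_eq_mul_inv]

lemma kk_measurable (χ : ℕ) (s : ℂ) : Measurable (kk χ s) := by
  have h : Measurable Real.sign := by
    unfold Real.sign
    exact Measurable.ite measurableSet_Iio measurable_const
      (Measurable.ite measurableSet_Ioi measurable_const measurable_const)
  unfold kk
  fun_prop

lemma kk_neg (χ : ℕ) (s : ℂ) (u : ℝ) : kk χ s (-u) = (-1) ^ (χ + 1) * kk χ s u := by
  simp only [kk, Real.sign_neg, abs_neg, Complex.ofReal_neg, neg_pow (Real.sign u : ℂ), inv_neg]
  ring

lemma kk_pos (χ : ℕ) (s : ℂ) (u : ℝ) (hu : 0 < u) : kk χ s u = (u : ℂ) ^ (s - 1) := by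
  have : (u : ℂ) ≠ 0 := by exact_mod_cast hu.ne'
  rw [kk, Real.sign_of_pos hu, abs_of_pos hu, Complex.cpow_sub _ _ this]
  simp [div_eq_mul_inv]

lemma kk_hasDerivAt (χ : ℕ) (hχ : χ ≤ 1) (s : ℂ) (hs : 1 < s.re) (u : ℝ) (hu : u ≠ 0) :
    HasDerivAt (kk χ s) ((s - 1) * kk ((χ + 1) % 2) (s - 1) u) u := by
  have hs1 : s - 1 ≠ 0 := by
    intro h
    have := congrArg Complex.re h
    simp at this; linarith
  have pos : ∀ v : ℝ, 0 < v → HasDerivAt (kk χ s) ((s - 1) * kk ((χ + 1) % 2) (s - 1) v) v := by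
    intro v hv
    rw [kk_pos _ _ _ hv]
    refine (hasDerivAt_ofReal_cpow_const hv.ne' hs1).congr_of_eventuallyEq ?_
    filter_upwards [lt_mem_nhds hv] with w hw
    exact kk_pos _ _ _ hw
  rcases lt_or_gt_of_ne hu with h | h
  · have h1 := (pos (-u) (by linarith))
    have h2 := (HasDerivAt.scomp u h1 (hasDerivAt_neg u)).const_mul ((-1 : ℂ) ^ (χ + 1))
    have e : (fun y => (-1 : ℂ) ^ (χ + 1) * ((kk χ s) ∘ Neg.neg) y) = kk χ s := by
      funext y
      simp only [Function.comp, kk_neg]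
      rw [← mul_assoc, ← mul_pow]; simp
    rw [← e]
    refine h2.congr_deriv ?_
    rw [kk_neg]
    interval_cases χ <;> simp
  · exact pos u h

lemma kk_continuous (χ : ℕ) (hχ : χ ≤ 1) (s : ℂ) (hs : 1 < s.re) : Continuous (kk χ s) := by
  rw [continuous_iff_continuousAt]
  intro u
  by_cases hu : u = 0
  · subst hu
    have h0 : kk χ s 0 = 0 := by simp [kk]
    unfold ContinuousAt
    rw [h0]
    refine squeeze_zero_norm (kk_norm_le χ s) ?_
    have : ContinuousAt (fun u : ℝ => |u| ^ (s.re - 1)) 0 :=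
      (continuous_abs.continuousAt).rpow_const (Or.inr (by linarith))
    unfold ContinuousAt at this
    simpa [Real.zero_rpow (by linarith : s.re - 1 ≠ 0)] using this
  · exact (kk_hasDerivAt χ hχ s hs u hu).continuousAt

lemma exp_rpow_integrable (c a : ℝ) (hc : 0 < c) (ha : -1 < a) :
    Integrable (fun u : ℝ => |u| ^ a * Real.exp (-c * |u|)) := by
  have h : IntegrableOn (fun u : ℝ => |u| ^ a * Real.exp (-c * |u|)) (Set.Ioi 0) := by
    refine (integrableOn_rpow_mul_exp_neg_mul_rpow (p := 1) ha one_pos hc).congr_fun ?_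
      measurableSet_Ioi
    intro u hu
    have : 0 < u := hu
    simp [abs_of_pos this]
  have h2 : IntegrableOn (fun u : ℝ => |u| ^ a * Real.exp (-c * |u|)) (Set.Iic 0) := by
    have := (Measure.measurePreserving_neg (volume : Measure ℝ)).integrableOn_comp_preimage
      (Homeomorph.neg ℝ).measurableEmbedding (f := fun u : ℝ => |u| ^ a * Real.exp (-c * |u|))
        (s := Set.Ioi 0) |>.2 h
    rw [integrableOn_Iic_iff_integrableOn_Iio]
    simpa [Function.comp_def] using this
  have := h2.union h
  rwa [Set.Iic_union_Ioi, integrableOn_univ] at this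

lemma kk_exp_integrable (χ : ℕ) (s : ℂ) (hs : 0 < s.re) (c : ℝ) (hc : 0 < c) :
    Integrable (fun u : ℝ => (Real.exp (-c * |u|) : ℂ) * kk χ s u) := by
  refine (exp_rpow_integrable c (s.re - 1) hc (by linarith)).mono' ?_ ?_
  · have := kk_measurable χ s
    exact (by fun_prop : Measurable _).aestronglyMeasurable
  · refine Filter.Eventually.of_forall fun u => ?_
    rw [norm_mul, Complex.norm_real, Real.norm_eq_abs, Real.abs_exp, mul_comm]
    exact mul_le_mul_of_nonneg_right (kk_norm_le _ _ _) (Real.exp_pos _).le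

lemma main_integrable {r : ℕ} (χ : Fin r → ℕ) (s : Fin r → ℂ) (hs : ∀ ρ, 0 < (s ρ).re)
    (c B : ℝ) (hc : 0 < c) (g : (Fin r → ℝ) → ℂ) (hg : Continuous g)
    (hb : ∀ t, ‖g t‖ ≤ B * Real.exp (-c * ∑ ρ, |t ρ|)) :
    Integrable (fun t => g t * ∏ ρ, kk (χ ρ) (s ρ) (t ρ)) := by
  have h := Integrable.fintype_prod (μ := fun _ : Fin r => (volume : Measure ℝ))
    (fun ρ => kk_exp_integrable (χ ρ) (s ρ) (hs ρ) c hc)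
  refine Integrable.mono' (h.norm.const_mul B) ?_ ?_
  · have := fun ρ => kk_measurable (χ ρ) (s ρ)
    refine hg.aestronglyMeasurable.mul (Measurable.aestronglyMeasurable ?_)
    exact Finset.measurable_prod _ fun ρ _ => (this ρ).comp (measurable_pi_apply ρ)
  · refine Filter.Eventually.of_forall fun t => ?_
    rw [norm_mul, Finset.prod_mul_distrib, norm_mul, ← mul_assoc]
    refine mul_le_mul_of_nonneg_right ((hb t).trans (le_of_eq ?_)) (norm_nonneg _)
    rw [norm_prod]
    simp only [Complex.norm_real, Real.norm_eq_abs, Real.abs_exp]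
    rw [Finset.mul_sum, Real.exp_sum]

/-- `h(z) = e(xz)/(1-e(z))` -/
def hh (x : ℝ) (z : ℂ) : ℂ := eC (x * z) / (1 - eC z)

/-- the derivative of `hh` -/
def hd (x : ℝ) (z : ℂ) : ℂ :=
  2 * Real.pi * Complex.I * (hh x z * (x + eC z / (1 - eC z)))

lemma eC_hasDerivAt (z : ℂ) : HasDerivAt eC (2 * Real.pi * Complex.I * eC z) z := by
  have h := ((hasDerivAt_id z).const_mul (2 * Real.pi * Complex.I : ℂ)).cexp
  refine h.congr_deriv ?_
  simp [eC, mul_comm]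

lemma eC_continuous : Continuous eC := by unfold eC; fun_prop

lemma eC_add (a b : ℂ) : eC (a + b) = eC a * eC b := by
  simp [eC, mul_add, Complex.exp_add]

lemma eC_sum {ι : Type*} (S : Finset ι) (f : ι → ℂ) : eC (∑ i ∈ S, f i) = ∏ i ∈ S, eC (f i) := by
  simp [eC, Finset.mul_sum, Complex.exp_sum]

lemma hh_hasDerivAt (x : ℝ) (z : ℂ) (hz : 1 - eC z ≠ 0) : HasDerivAt (hh x) (hd x z) z := by
  have h1 : HasDerivAt (fun z : ℂ => eC (x * z)) (2 * Real.pi * Complex.I * eC (x * z) * x) z := by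
    have := (eC_hasDerivAt (x * z)).comp z ((hasDerivAt_id z).const_mul (x : ℂ))
    refine this.congr_deriv ?_
    simp
  have h2 := (eC_hasDerivAt z).const_sub 1
  refine (h1.div h2 hz).congr_deriv ?_
  unfold hd hh
  field_simp
  ring

lemma eC_norm (x y w : ℝ) : ‖eC (x * (y + Complex.I * w))‖ = Real.exp (-(2 * Real.pi * w * x)) := by
  rw [eC, Complex.norm_exp]
  congr 1
  simp
  ring

lemma den_bound (y w δ : ℝ) (hδ : 0 < δ) (hy : δ ≤ Real.sin (Real.pi * y)) :
    δ / 2 * (1 + Real.exp (-(2 * Real.pi * w))) ≤ ‖1 - eC (y + Complex.I * w)‖ := by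
  set E := Real.exp (-(2 * Real.pi * w)) with hE
  have hEp : 0 < E := Real.exp_pos _
  have he : eC (y + Complex.I * w) =
      ((E * Real.cos (2 * (Real.pi * y)) : ℝ) : ℂ) + ((E * Real.sin (2 * (Real.pi * y)) : ℝ) : ℂ) * Complex.I := by
    have : (2 * Real.pi * Complex.I * (y + Complex.I * w) : ℂ) =
        ((-(2 * Real.pi * w) : ℝ) : ℂ) + ((2 * (Real.pi * y) : ℝ) : ℂ) * Complex.I := by
      push_cast
      linear_combination (2 * Real.pi * w : ℂ) * Complex.I_mul_I
    rw [eC, this, Complex.exp_add, Complex.exp_mul_I, ← Complex.ofReal_exp, ← Complex.ofReal_cos,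
      ← Complex.ofReal_sin, ← hE]
    push_cast
    ring
  have hsq : ‖1 - eC (y + Complex.I * w)‖ ^ 2 =
      1 - 2 * E * Real.cos (2 * (Real.pi * y)) + E ^ 2 := by
    rw [he, ← Complex.normSq_eq_norm_sq, Complex.normSq_apply]
    simp only [Complex.sub_re, Complex.sub_im, Complex.add_re, Complex.add_im, Complex.one_re,
      Complex.one_im, Complex.ofReal_re, Complex.ofReal_im, Complex.re_ofReal_mul,
      Complex.im_ofReal_mul, Complex.I_re, Complex.I_im]
    have := Real.sin_sq_add_cos_sq (2 * (Real.pi * y))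
    linear_combination E ^ 2 * this
  refine le_of_sq_le_sq ?_ (norm_nonneg _)
  rw [hsq, Real.cos_two_mul, Real.cos_sq']
  set S := Real.sin (Real.pi * y)
  have hS1 : S ^ 2 ≤ 1 := Real.sin_sq_le_one _
  have hSd : δ ^ 2 ≤ S ^ 2 := by gcongr
  have h1 : (δ / 2 * (1 + E)) ^ 2 ≤ S ^ 2 * (1 + E ^ 2) := by
    have : (δ / 2 * (1 + E)) ^ 2 = δ ^ 2 * ((1 + E) ^ 2 / 4) := by ring
    rw [this]
    refine mul_le_mul hSd ?_ (by positivity) (by positivity)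
    nlinarith [sq_nonneg (1 - E)]
  nlinarith [mul_nonneg (sub_nonneg.2 hS1) (sq_nonneg (1 - E)), mul_nonneg (sq_nonneg S) hEp.le]

lemma den_ne (y w : ℝ) (hy : 0 < Real.sin (Real.pi * y)) : 1 - eC (y + Complex.I * w) ≠ 0 := by
  have := den_bound y w _ hy le_rfl
  intro h
  rw [h, norm_zero] at this
  have h2 : 0 < Real.sin (Real.pi * y) / 2 * (1 + Real.exp (-(2 * Real.pi * w))) := by positivity
  linarith

lemma hh_bound (x y w δ c : ℝ) (hδ : 0 < δ) (hy : δ ≤ Real.sin (Real.pi * y))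
    (hc1 : c ≤ 2 * Real.pi * x) (hc2 : c ≤ 2 * Real.pi * (1 - x)) :
    ‖hh x (y + Complex.I * w)‖ ≤ 2 / δ * Real.exp (-c * |w|) := by
  have hd := den_bound y w δ hδ hy
  have hp : 0 < δ / 2 * (1 + Real.exp (-(2 * Real.pi * w))) := by positivity
  rw [hh, norm_div, eC_norm, div_le_iff₀ (hp.trans_le hd)]
  have key : Real.exp (-(2 * Real.pi * w * x)) ≤
      Real.exp (-c * |w|) * (1 + Real.exp (-(2 * Real.pi * w))) := by
    rw [mul_add, mul_one, ← Real.exp_add]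
    rcases le_total 0 w with h | h
    · have : Real.exp (-(2 * Real.pi * w * x)) ≤ Real.exp (-c * |w|) := by
        rw [abs_of_nonneg h]
        apply Real.exp_le_exp.2
        nlinarith
      have := Real.exp_pos (-c * |w| + -(2 * Real.pi * w))
      linarith
    · have : Real.exp (-(2 * Real.pi * w * x)) ≤ Real.exp (-c * |w| + -(2 * Real.pi * w)) := by
        rw [abs_of_nonpos h]
        apply Real.exp_le_exp.2
        nlinarith
      have := Real.exp_pos (-c * |w|)
      linarith
  calc _ ≤ _ := key
    _ = 2 / δ * Real.exp (-c * |w|) * (δ / 2 * (1 + Real.exp (-(2 * Real.pi * w)))) := by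
      field_simp
    _ ≤ _ := by gcongr

lemma hd_bound (x y w δ c : ℝ) (hx0 : 0 ≤ x) (hx1 : x ≤ 1)
    (hδ : 0 < δ) (hy : δ ≤ Real.sin (Real.pi * y))
    (hc1 : c ≤ 2 * Real.pi * x) (hc2 : c ≤ 2 * Real.pi * (1 - x)) :
    ‖hd x (y + Complex.I * w)‖ ≤
      2 * Real.pi * (2 / δ * (1 + 2 / δ)) * Real.exp (-c * |w|) := by
  have h1 := hh_bound x y w δ c hδ hy hc1 hc2
  have h2 : ‖eC (y + Complex.I * w) / (1 - eC (y + Complex.I * w))‖ ≤ 2 / δ := by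
    have := hh_bound 1 y w δ 0 hδ hy (by positivity) (by simp)
    simpa [hh] using this
  have h3 : ‖(x : ℂ) + eC (y + Complex.I * w) / (1 - eC (y + Complex.I * w))‖ ≤ 1 + 2 / δ := by
    refine (norm_add_le _ _).trans (add_le_add ?_ h2)
    rw [Complex.norm_real, Real.norm_eq_abs, abs_of_nonneg hx0]; exact hx1
  rw [hd, norm_mul, norm_mul (hh _ _)]
  have h4 : ‖(2 * Real.pi * Complex.I : ℂ)‖ = 2 * Real.pi := by
    simp [abs_of_pos Real.pi_pos]
  rw [h4]
  calc _ ≤ 2 * Real.pi * ((2 / δ * Real.exp (-c * |w|)) * (1 + 2 / δ)) := by gcongr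
    _ = _ := by ring

/-- `G(w,y) = e(x·y) F(w,x,y)` -/
def GG {r : ℕ} (x y w : Fin r → ℝ) : ℂ := ∏ ρ, hh (x ρ) (y ρ + Complex.I * w ρ)

/-- the partial derivative of `G` in `y_ν` -/
def DD {r : ℕ} (x : Fin r → ℝ) (ν : Fin r) (y w : Fin r → ℝ) : ℂ :=
  ∏ ρ, if ρ = ν then hd (x ρ) (y ρ + Complex.I * w ρ) else hh (x ρ) (y ρ + Complex.I * w ρ)

lemma DD_eq {r : ℕ} (x : Fin r → ℝ) (ν : Fin r) (y w : Fin r → ℝ) :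
    DD x ν y w = (∏ ρ ∈ Finset.univ.erase ν, hh (x ρ) (y ρ + Complex.I * w ρ)) *
      hd (x ν) (y ν + Complex.I * w ν) := by
  rw [DD, ← Finset.prod_erase_mul _ _ (Finset.mem_univ ν), if_pos rfl]
  congr 1
  refine Finset.prod_congr rfl fun ρ hρ => ?_
  rw [if_neg (Finset.ne_of_mem_erase hρ)]

lemma GG_eq {r : ℕ} (x y w : Fin r → ℝ) :
    GG x y w = eC ((∑ ν, x ν * y ν : ℝ) : ℂ) * FF w x y := by
  push_cast
  rw [eC_sum, FF, ← Finset.prod_mul_distrib, GG]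
  refine Finset.prod_congr rfl fun ρ _ => ?_
  rw [phiF, hh, mul_div_assoc', ← eC_add]
  congr 2
  ring

lemma RChi_eq {r : ℕ} (χ : Fin r → ℕ) (s : Fin r → ℂ)
    (A : Matrix (Fin r) (Fin r) ℝ) (x y : Fin r → ℝ) :
    RChi χ s A x y = (∏ ν, GammaC (s ν))⁻¹ *
      ∫ t : Fin r → ℝ, GG x y (Matrix.vecMul t A) * ∏ ρ, kk (χ ρ) (s ρ) (t ρ) := by
  rw [RChi, ShintaniLchi, mul_left_comm, ← integral_const_mul]
  congr 2
  funext t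
  rw [GG_eq, qchar]
  simp only [kk, Finset.prod_mul_distrib]
  ring

lemma hh_continuous (x y : ℝ) (hy : 0 < Real.sin (Real.pi * y)) :
    Continuous (fun w : ℝ => hh x (y + Complex.I * w)) := by
  unfold hh
  have := eC_continuous
  exact Continuous.div (by fun_prop) (by fun_prop) fun w => den_ne y w hy

lemma hd_continuous (x y : ℝ) (hy : 0 < Real.sin (Real.pi * y)) :
    Continuous (fun w : ℝ => hd x (y + Complex.I * w)) := by
  have h1 := hh_continuous x y hy
  have h2 := hh_continuous 1 y hy
  simp only [hh, Complex.ofReal_one, one_mul] at h2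
  unfold hd
  fun_prop

lemma GG_continuous {r : ℕ} (x y : Fin r → ℝ) (hy : ∀ ρ, 0 < Real.sin (Real.pi * y ρ)) :
    Continuous (GG x y) := by
  unfold GG
  exact continuous_finsetProd _ fun ρ _ => (hh_continuous (x ρ) (y ρ) (hy ρ)).comp
    (continuous_apply ρ)

lemma DD_continuous {r : ℕ} (x y : Fin r → ℝ) (hy : ∀ ρ, 0 < Real.sin (Real.pi * y ρ))
    (ν : Fin r) : Continuous (DD x ν y) := by
  unfold DD
  refine continuous_finsetProd _ fun ρ _ => ?_
  split_ifs
  · exact (hd_continuous (x ρ) (y ρ) (hy ρ)).comp (continuous_apply ρ)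
  · exact (hh_continuous (x ρ) (y ρ) (hy ρ)).comp (continuous_apply ρ)

lemma exists_lower {r : ℕ} (f : Fin r → ℝ) (hf : ∀ ρ, 0 < f ρ) : ∃ c > 0, ∀ ρ, c ≤ f ρ := by
  obtain h | h := isEmpty_or_nonempty (Fin r)
  · exact ⟨1, one_pos, fun ρ => h.elim ρ⟩
  · obtain ⟨ρ, hρ⟩ := Finite.exists_min f
    exact ⟨f ρ, hf ρ, hρ⟩

lemma prod_bound {r : ℕ} (g : Fin r → ℂ) (w : Fin r → ℝ) (M c : ℝ)
    (h : ∀ ρ, ‖g ρ‖ ≤ M * Real.exp (-c * |w ρ|)) :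
    ‖∏ ρ, g ρ‖ ≤ M ^ r * Real.exp (-c * ∑ ρ, |w ρ|) := by
  rw [norm_prod]
  refine (Finset.prod_le_prod (fun _ _ => norm_nonneg _) fun ρ _ => h ρ).trans (le_of_eq ?_)
  rw [Finset.prod_mul_distrib, Finset.mul_sum, Real.exp_sum]
  simp

lemma linear_bound {r : ℕ} (A : Matrix (Fin r) (Fin r) ℝ) (hA : A.det ≠ 0) :
    ∃ K > 0, ∀ t : Fin r → ℝ, ∑ ρ, |t ρ| ≤ K * ∑ ρ, |Matrix.vecMul t A ρ| := by
  refine ⟨1 + ∑ μ, ∑ ρ, |A⁻¹ ρ μ|, by positivity, fun t => ?_⟩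
  set w := Matrix.vecMul t A with hw
  have ht : t = Matrix.vecMul w A⁻¹ := by
    rw [hw, Matrix.vecMul_vecMul, Matrix.mul_nonsing_inv _ (isUnit_iff_ne_zero.2 hA),
      Matrix.vecMul_one]
  have h1 : ∀ μ, |t μ| ≤ (∑ ρ, |A⁻¹ ρ μ|) * ∑ ρ, |w ρ| := by
    intro μ
    rw [ht, Matrix.vecMul, dotProduct, Finset.sum_mul]
    refine (Finset.abs_sum_le_sum_abs _ _).trans (Finset.sum_le_sum fun ρ _ => ?_)
    rw [abs_mul, mul_comm]
    exact mul_le_mul_of_nonneg_left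
      (Finset.single_le_sum (f := fun ρ => |w ρ|) (fun _ _ => abs_nonneg _) (Finset.mem_univ ρ))
      (abs_nonneg _)
  have h2 : ∑ μ, |t μ| ≤ (∑ μ, ∑ ρ, |A⁻¹ ρ μ|) * ∑ ρ, |w ρ| := by
    rw [Finset.sum_mul]
    exact Finset.sum_le_sum fun μ _ => h1 μ
  have h3 : 0 ≤ ∑ ρ, |w ρ| := by positivity
  linarith

lemma exists_bound {r : ℕ} (A : Matrix (Fin r) (Fin r) ℝ) (hA : A.det ≠ 0) (x : Fin r → ℝ)
    (hx : ∀ ν, x ν ∈ Set.Ioo (0 : ℝ) 1) (δ : ℝ) (hδ : 0 < δ) :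
    ∃ c > 0, ∃ B : ℝ, ∀ y : Fin r → ℝ, (∀ ρ, δ ≤ Real.sin (Real.pi * y ρ)) → ∀ t : Fin r → ℝ,
      ‖GG x y (Matrix.vecMul t A)‖ ≤ B * Real.exp (-c * ∑ ρ, |t ρ|) ∧
      ∀ ν, ‖DD x ν y (Matrix.vecMul t A)‖ ≤ B * Real.exp (-c * ∑ ρ, |t ρ|) := by
  obtain ⟨K, hK, hKt⟩ := linear_bound A hA
  obtain ⟨c, hc, hcx⟩ := exists_lower
    (fun ρ => min (2 * Real.pi * x ρ) (2 * Real.pi * (1 - x ρ))) (fun ρ => by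
      have h1 := (hx ρ).1
      have h2 := sub_pos.2 (hx ρ).2
      positivity)
  set M := max (2 / δ) (2 * Real.pi * (2 / δ * (1 + 2 / δ))) with hM
  have hM0 : 0 ≤ M := le_trans (by positivity) (le_max_left _ _)
  refine ⟨c / K, by positivity, M ^ r, fun y hy t => ?_⟩
  set w := Matrix.vecMul t A with hw
  have hexp : M ^ r * Real.exp (-c * ∑ ρ, |w ρ|) ≤ M ^ r * Real.exp (-(c / K) * ∑ ρ, |t ρ|) := by
    refine mul_le_mul_of_nonneg_left (Real.exp_le_exp.2 ?_) (by positivity)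
    have h := mul_le_mul_of_nonneg_left (hKt t) (by positivity : 0 ≤ c / K)
    have e : c / K * (K * ∑ ρ, |w ρ|) = c * ∑ ρ, |w ρ| := by field_simp
    rw [← hw, e] at h
    linarith
  have hb : ∀ ρ, ‖hh (x ρ) (y ρ + Complex.I * w ρ)‖ ≤ M * Real.exp (-c * |w ρ|) := fun ρ =>
    (hh_bound (x ρ) (y ρ) (w ρ) δ c hδ (hy ρ) ((hcx ρ).trans (min_le_left _ _))
      ((hcx ρ).trans (min_le_right _ _))).trans
      (mul_le_mul_of_nonneg_right (le_max_left _ _) (Real.exp_pos _).le)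
  have hb' : ∀ ρ, ‖hd (x ρ) (y ρ + Complex.I * w ρ)‖ ≤ M * Real.exp (-c * |w ρ|) := fun ρ =>
    (hd_bound (x ρ) (y ρ) (w ρ) δ c (hx ρ).1.le (hx ρ).2.le hδ (hy ρ)
      ((hcx ρ).trans (min_le_left _ _))
      ((hcx ρ).trans (min_le_right _ _))).trans
      (mul_le_mul_of_nonneg_right (le_max_right _ _) (Real.exp_pos _).le)
  refine ⟨(prod_bound _ w M c hb).trans hexp, fun ν => (prod_bound _ w M c ?_).trans hexp⟩
  intro ρ
  split_ifs
  · exact hb' ρ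
  · exact hb ρ

lemma GG_hasDerivAt_y {r : ℕ} (x y w : Fin r → ℝ) (ν : Fin r) (u : ℝ)
    (hu : 0 < Real.sin (Real.pi * u)) :
    HasDerivAt (fun u : ℝ => GG x (Function.update y ν u) w)
      (DD x ν (Function.update y ν u) w) u := by
  have h1 : ∀ v : ℝ, (∏ ρ ∈ Finset.univ.erase ν,
      hh (x ρ) ((Function.update y ν v ρ : ℝ) + Complex.I * w ρ)) =
      ∏ ρ ∈ Finset.univ.erase ν, hh (x ρ) (y ρ + Complex.I * w ρ) := fun v =>
    Finset.prod_congr rfl fun ρ hρ => by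
      rw [Function.update_of_ne (Finset.ne_of_mem_erase hρ)]
  have h2 : (fun u : ℝ => GG x (Function.update y ν u) w) = fun u : ℝ =>
      (∏ ρ ∈ Finset.univ.erase ν, hh (x ρ) (y ρ + Complex.I * w ρ)) *
        hh (x ν) (u + Complex.I * w ν) := by
    funext v
    rw [GG, ← Finset.prod_erase_mul _ _ (Finset.mem_univ ν), h1, Function.update_self]
  rw [h2, DD_eq, h1, Function.update_self]
  refine HasDerivAt.const_mul _ ?_
  have h3 := (hh_hasDerivAt (x ν) (u + Complex.I * w ν) (den_ne u (w ν) hu))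
  have h4 : HasDerivAt (fun u : ℝ => (u : ℂ) + Complex.I * w ν) 1 u :=
    (Complex.ofRealCLM.hasDerivAt (x := u)).add_const _
  have h5 := h3.comp u h4
  rw [mul_one] at h5
  exact h5

lemma vecMul_update {r : ℕ} (A : Matrix (Fin r) (Fin r) ℝ) (t : Fin r → ℝ) (μ ρ : Fin r) (u : ℝ) :
    Matrix.vecMul (Function.update t μ u) A ρ = Matrix.vecMul t A ρ + (u - t μ) * A μ ρ := by
  have : Function.update t μ u = t + (u - t μ) • Pi.single μ 1 := by
    funext i
    by_cases h : i = μ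
    · subst h; simp
    · simp [h]
  rw [this, Matrix.add_vecMul, Matrix.smul_vecMul]
  simp

lemma GG_hasDerivAt_t {r : ℕ} (A : Matrix (Fin r) (Fin r) ℝ) (x y t : Fin r → ℝ) (μ : Fin r)
    (hy : ∀ ρ, 0 < Real.sin (Real.pi * y ρ)) :
    HasDerivAt (fun u : ℝ => GG x y (Matrix.vecMul (Function.update t μ u) A))
      (∑ ρ, (A μ ρ : ℂ) * (Complex.I * DD x ρ y (Matrix.vecMul t A))) (t μ) := by
  unfold GG
  have h := HasDerivAt.fun_finsetProd (u := Finset.univ) (x := t μ)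
    (f := fun ρ (u : ℝ) =>
      hh (x ρ) (y ρ + Complex.I * (Matrix.vecMul (Function.update t μ u) A ρ : ℝ)))
    (f' := fun ρ => hd (x ρ) (y ρ + Complex.I * (Matrix.vecMul t A ρ : ℝ)) *
      (Complex.I * A μ ρ)) (fun ρ _ => by
      have h3 := (hh_hasDerivAt (x ρ) (y ρ + Complex.I * (Matrix.vecMul t A ρ : ℝ))
        (den_ne (y ρ) _ (hy ρ)))
      have h4 : HasDerivAt (fun u : ℝ => (y ρ : ℂ) + Complex.I *
          (Matrix.vecMul (Function.update t μ u) A ρ : ℝ)) (Complex.I * A μ ρ) (t μ) := by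
        simp only [vecMul_update]
        have h5 : HasDerivAt (fun u : ℝ => Matrix.vecMul t A ρ + (u - t μ) * A μ ρ) (A μ ρ) (t μ) := by
          have := (((hasDerivAt_id (t μ)).sub_const (t μ)).mul_const (A μ ρ)).const_add
            (Matrix.vecMul t A ρ)
          simpa using this
        exact (h5.ofReal_comp.const_mul Complex.I).const_add _
      exact HasDerivAt.comp (t μ) (by rw [Function.update_eq_self]; exact h3) h4)
  refine h.congr_deriv ?_
  refine Finset.sum_congr rfl fun ρ _ => ?_
  rw [DD_eq, Function.update_eq_self, smul_eq_mul]
  ring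

lemma KK_hasDerivAt {r : ℕ} (χ : Fin r → ℕ) (hχ : ∀ ν, χ ν ≤ 1) (s : Fin r → ℂ)
    (hs : ∀ ν, 1 < (s ν).re) (t : Fin r → ℝ) (μ : Fin r) (ht : t μ ≠ 0) :
    HasDerivAt (fun u : ℝ => ∏ ρ, kk (χ ρ) (s ρ) (Function.update t μ u ρ))
      ((s μ - 1) * ∏ ρ, kk (if ρ = μ then (χ ρ + 1) % 2 else χ ρ)
        (if ρ = μ then s ρ - 1 else s ρ) (t ρ)) (t μ) := by
  have h2 : (fun u : ℝ => ∏ ρ, kk (χ ρ) (s ρ) (Function.update t μ u ρ)) = fun u : ℝ =>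
      (∏ ρ ∈ Finset.univ.erase μ, kk (χ ρ) (s ρ) (t ρ)) * kk (χ μ) (s μ) u := by
    funext v
    rw [← Finset.prod_erase_mul _ _ (Finset.mem_univ μ), Function.update_self]
    congr 1
    exact Finset.prod_congr rfl fun ρ hρ => by
      rw [Function.update_of_ne (Finset.ne_of_mem_erase hρ)]
  rw [h2]
  refine ((kk_hasDerivAt (χ μ) (hχ μ) (s μ) (hs μ) (t μ) ht).const_mul _).congr_deriv ?_
  rw [← Finset.prod_erase_mul Finset.univ (fun ρ => kk (if ρ = μ then (χ ρ + 1) % 2 else χ ρ)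
        (if ρ = μ then s ρ - 1 else s ρ) (t ρ)) (Finset.mem_univ μ)]
  have : (∏ ρ ∈ Finset.univ.erase μ, kk (if ρ = μ then (χ ρ + 1) % 2 else χ ρ)
        (if ρ = μ then s ρ - 1 else s ρ) (t ρ)) =
        ∏ ρ ∈ Finset.univ.erase μ, kk (χ ρ) (s ρ) (t ρ) :=
    Finset.prod_congr rfl fun ρ hρ => by
      rw [if_neg (Finset.ne_of_mem_erase hρ), if_neg (Finset.ne_of_mem_erase hρ)]
  rw [this]
  simp only [if_true]
  ring

lemma GammaC_rec (s : ℂ) (hs : 1 < s.re) : (s - 1) * GammaC (s - 1) = 2 * Real.pi * GammaC s := by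
  have hs1 : s - 1 ≠ 0 := by
    intro h
    have := congrArg Complex.re h
    simp at this; linarith
  have h2 : (2 * (Real.pi : ℂ)) ≠ 0 := by simp [Real.pi_ne_zero]
  have h := Complex.Gamma_add_one (s - 1) hs1
  rw [sub_add_cancel] at h
  have h3 : (2 * (Real.pi : ℂ)) ^ (-(s - 1)) = (2 * (Real.pi : ℂ)) ^ (-s) * (2 * Real.pi) := by
    rw [neg_sub, sub_eq_neg_add, Complex.cpow_add _ _ h2, Complex.cpow_one]
  rw [GammaC, GammaC, h, h3]
  ring

lemma GammaC_ne (s : ℂ) (hs : 0 < s.re) : GammaC s ≠ 0 := by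
  have h2 : (2 * (Real.pi : ℂ)) ≠ 0 := by simp [Real.pi_ne_zero]
  unfold GammaC
  have := Complex.Gamma_ne_zero_of_re_pos hs
  simp [Complex.cpow_eq_zero_iff, h2, this]

lemma Gamma_prod {r : ℕ} (s : Fin r → ℂ) (hs : ∀ ν, 1 < (s ν).re) (μ : Fin r) :
    (s μ - 1) * (∏ ρ, GammaC (s ρ))⁻¹ =
      2 * Real.pi * (∏ ρ, GammaC (if ρ = μ then s ρ - 1 else s ρ))⁻¹ := by
  rw [← Finset.prod_erase_mul _ _ (Finset.mem_univ μ),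
    ← Finset.prod_erase_mul Finset.univ (fun ρ => GammaC (if ρ = μ then s ρ - 1 else s ρ))
      (Finset.mem_univ μ)]
  have : (∏ ρ ∈ Finset.univ.erase μ, GammaC (if ρ = μ then s ρ - 1 else s ρ)) =
        ∏ ρ ∈ Finset.univ.erase μ, GammaC (s ρ) :=
    Finset.prod_congr rfl fun ρ hρ => by
      rw [if_neg (Finset.ne_of_mem_erase hρ)]
  rw [this]
  simp only [if_true]
  have h1 := GammaC_rec (s μ) (hs μ)
  have h2 := GammaC_ne (s μ) (by linarith [hs μ])
  have h3 := GammaC_ne (s μ - 1) (by simpa using hs μ)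
  rw [mul_inv, mul_inv]
  field_simp
  linear_combination (∏ ρ ∈ Finset.univ.erase μ, GammaC (s ρ))⁻¹ * h1

theorem stmt_15 (r : ℕ) (hr : 1 ≤ r) (χ : Fin r → ℕ) (hχ : ∀ ν, χ ν ≤ 1)
    (A : Matrix (Fin r) (Fin r) ℝ) (hA : A.det ≠ 0) (x y : Fin r → ℝ)
    (hx : ∀ ν, x ν ∈ Set.Ioo (0 : ℝ) 1) (hy : ∀ ν, y ν ∈ Set.Ioo (0 : ℝ) 1)
    (s : Fin r → ℂ) (hs : ∀ ν, 1 < (s ν).re) (ν : Fin r) :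
    HasDerivAt (fun u : ℝ => RChi χ s A x (Function.update y ν u))
      (2 * (Real.pi : ℂ) * Complex.I * ∑ μ, ((A.transpose⁻¹ μ ν : ℝ) : ℂ) *
        RChi (fun ρ => if ρ = μ then (χ ρ + 1) % 2 else χ ρ)
          (fun ρ => if ρ = μ then s ρ - 1 else s ρ) A x y)
      (y ν) := by

  have hsin : ∀ ρ, 0 < Real.sin (Real.pi * y ρ) := fun ρ => by
    have h1 := (hy ρ).1
    have h2 := (hy ρ).2
    have := Real.pi_pos
    exact Real.sin_pos_of_pos_of_lt_pi (by positivity) (by nlinarith)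
  obtain ⟨δ, hδ, hδy⟩ := exists_lower (fun ρ => Real.sin (Real.pi * y ρ) / 2)
    (fun ρ => half_pos (hsin ρ))
  obtain ⟨c, hc, B, hB⟩ := exists_bound A hA x hx δ hδ
  have hδy' : ∀ ρ, δ ≤ Real.sin (Real.pi * y ρ) := fun ρ =>
    (hδy ρ).trans (by linarith [hsin ρ])
  have hs0 : ∀ ρ, 0 < (s ρ).re := fun ρ => by linarith [hs ρ]
  have hcA : Continuous fun t : Fin r → ℝ => Matrix.vecMul t A :=
    Continuous.matrix_vecMul continuous_id continuous_const
  set K : (Fin r → ℝ) → ℂ := fun t => ∏ ρ, kk (χ ρ) (s ρ) (t ρ) with hK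
  have hKm : Measurable K := by
    have := fun ρ => kk_measurable (χ ρ) (s ρ)
    exact Finset.measurable_prod _ fun ρ _ => (this ρ).comp (measurable_pi_apply ρ)
  have hU : {u : ℝ | δ < Real.sin (Real.pi * u)} ∈ nhds (y ν) := by
    refine IsOpen.mem_nhds (isOpen_lt continuous_const (by fun_prop)) ?_
    exact (hδy ν).trans_lt (by linarith [hsin ν])
  have hupd : ∀ u : ℝ, δ < Real.sin (Real.pi * u) →
      ∀ ρ, δ ≤ Real.sin (Real.pi * Function.update y ν u ρ) := by
    intro u hu ρ
    by_cases h : ρ = ν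
    · subst h; rw [Function.update_self]; exact hu.le
    · rw [Function.update_of_ne h]; exact hδy' ρ
  have hbound : Integrable (fun t : Fin r → ℝ => ‖((B * Real.exp (-c * ∑ ρ, |t ρ|) : ℝ) : ℂ) * K t‖) := by
    refine (main_integrable χ s hs0 c |B| hc _ (by fun_prop) fun t => ?_).norm
    rw [Complex.norm_real, Real.norm_eq_abs, abs_mul, Real.abs_exp]
  have hDer := (hasDerivAt_integral_of_dominated_loc_of_deriv_le (μ := volume) (x₀ := y ν)
    (F := fun u t => GG x (Function.update y ν u) (Matrix.vecMul t A) * K t)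
    (F' := fun u t => DD x ν (Function.update y ν u) (Matrix.vecMul t A) * K t)
    (bound := fun t : Fin r → ℝ => ‖((B * Real.exp (-c * ∑ ρ, |t ρ|) : ℝ) : ℂ) * K t‖)
    hU
    (by
      filter_upwards [hU] with u hu
      exact ((GG_continuous x _ fun ρ => hδ.trans_le (hupd u hu ρ)).comp
        hcA).aestronglyMeasurable.mul hKm.aestronglyMeasurable)
    (by
      simp only [Function.update_eq_self]
      exact main_integrable χ s hs0 c B hc _ ((GG_continuous x y hsin).comp hcA)
        fun t => (hB y hδy' t).1)
    (by
      simp only [Function.update_eq_self]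
      exact ((DD_continuous x y hsin ν).comp hcA).aestronglyMeasurable.mul
        hKm.aestronglyMeasurable)
    (by
      refine Filter.Eventually.of_forall fun t u hu => ?_
      rw [norm_mul, norm_mul]
      refine mul_le_mul_of_nonneg_right ?_ (norm_nonneg _)
      refine ((hB _ (hupd u hu) t).2 ν).trans ?_
      rw [Complex.norm_real]
      exact le_abs_self _)
    hbound
    (by
      refine Filter.Eventually.of_forall fun t u hu => ?_
      exact (GG_hasDerivAt_y x y _ ν u (hδ.trans hu)).mul_const _)).2
  simp only [Function.update_eq_self] at hDer
  have hRfun : (fun u : ℝ => RChi χ s A x (Function.update y ν u)) = fun u =>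
      (∏ ν, GammaC (s ν))⁻¹ *
        ∫ t, GG x (Function.update y ν u) (Matrix.vecMul t A) * K t := by
    funext u
    rw [RChi_eq]
  rw [hRfun]
  refine (hDer.const_mul _).congr_deriv ?_
  have hDint : ∀ ρ, Integrable fun t => DD x ρ y (Matrix.vecMul t A) * K t := fun ρ =>
    main_integrable χ s hs0 c B hc _ ((DD_continuous x y hsin ρ).comp hcA)
        fun t => (hB y hδy' t).2 ρ
  set K' : Fin r → (Fin r → ℝ) → ℂ := fun μ t =>
    ∏ ρ, kk (if ρ = μ then (χ ρ + 1) % 2 else χ ρ) (if ρ = μ then s ρ - 1 else s ρ) (t ρ) with hK'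
  have hGint' : ∀ μ, Integrable fun t => GG x y (Matrix.vecMul t A) * K' μ t := fun μ =>
    main_integrable (fun ρ => if ρ = μ then (χ ρ + 1) % 2 else χ ρ)
      (fun ρ => if ρ = μ then s ρ - 1 else s ρ) (fun ρ => by
        split_ifs
        · simpa using hs ρ
        · exact hs0 ρ) c B hc _ ((GG_continuous x y hsin).comp hcA)
        fun t => (hB y hδy' t).1
  have hibp : ∀ μ, ∑ ρ, (A μ ρ : ℂ) * (Complex.I * ∫ t, DD x ρ y (Matrix.vecMul t A) * K t) =
      -((s μ - 1) * ∫ t, GG x y (Matrix.vecMul t A) * K' μ t) := by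
    intro μ
    have hi : Integrable fun t => ∑ ρ, (A μ ρ : ℂ) *
        (Complex.I * (DD x ρ y (Matrix.vecMul t A) * K t)) :=
      integrable_finsetSum _ fun ρ _ => ((hDint ρ).const_mul _).const_mul _
    have h0 := ibp_aux (fun t => GG x y (Matrix.vecMul t A) * K t)
      (fun t => (∑ ρ, (A μ ρ : ℂ) * (Complex.I * (DD x ρ y (Matrix.vecMul t A) * K t))) +
        (s μ - 1) * (GG x y (Matrix.vecMul t A) * K' μ t)) μ
      (main_integrable χ s hs0 c B hc _ ((GG_continuous x y hsin).comp hcA)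
        fun t => (hB y hδy' t).1)
      (hi.add ((hGint' μ).const_mul _))
      (by
        intro t
        have h1 : Continuous K := continuous_finsetProd _ fun ρ _ =>
          (kk_continuous (χ ρ) (hχ ρ) (s ρ) (hs ρ)).comp (continuous_apply ρ)
        have h2 : Continuous fun u : ℝ => Function.update t μ u :=
          continuous_const.update μ continuous_id
        exact (((GG_continuous x y hsin).comp hcA).mul h1).comp h2)
      (by
        intro t ht
        have h1 := GG_hasDerivAt_t A x y t μ hsin
        have h2 := KK_hasDerivAt χ hχ s hs t μ ht
        refine (h1.mul h2).congr_deriv ?_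
        simp only [Function.update_eq_self]
        rw [Finset.sum_mul]
        congr 1
        · refine Finset.sum_congr rfl fun ρ _ => ?_
          rw [hK]; ring
        · rw [hK']; ring)
    rw [integral_add hi ((hGint' μ).const_mul _), integral_const_mul,
      integral_finsetSum _ (fun ρ _ => ((hDint ρ).const_mul _).const_mul _)] at h0
    simp only [integral_const_mul] at h0
    exact eq_neg_of_add_eq_zero_left h0
  set J : Fin r → ℂ := fun ρ => ∫ t, DD x ρ y (Matrix.vecMul t A) * K t with hJ
  have hinv : J ν = ∑ μ, (A⁻¹ ν μ : ℂ) * ∑ ρ, (A μ ρ : ℂ) * J ρ := by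
    have h1 : ∀ ρ, ∑ μ, (A⁻¹ ν μ : ℂ) * (A μ ρ : ℂ) = if ν = ρ then 1 else 0 := by
      intro ρ
      have := congrFun (congrFun (Matrix.nonsing_inv_mul A (isUnit_iff_ne_zero.2 hA)) ν) ρ
      rw [Matrix.mul_apply, Matrix.one_apply] at this
      have h2 := congrArg (fun a : ℝ => (a : ℂ)) this
      push_cast at h2
      rw [h2]
      split_ifs <;> simp
    simp_rw [Finset.mul_sum]
    rw [Finset.sum_comm]
    simp_rw [← mul_assoc, ← Finset.sum_mul, h1]
    simp
  have hsum : ∀ μ, ∑ ρ, (A μ ρ : ℂ) * J ρ =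
      Complex.I * ((s μ - 1) * ∫ t, GG x y (Matrix.vecMul t A) * K' μ t) := by
    intro μ
    have h := hibp μ
    have e : ∑ ρ, (A μ ρ : ℂ) * (Complex.I * ∫ t, DD x ρ y (Matrix.vecMul t A) * K t) =
        Complex.I * ∑ ρ, (A μ ρ : ℂ) * J ρ := by
      rw [Finset.mul_sum]
      exact Finset.sum_congr rfl fun ρ _ => by rw [hJ]; ring
    rw [e] at h
    linear_combination (-Complex.I) * h + (∑ ρ, (A μ ρ : ℂ) * J ρ) * Complex.I_mul_I
  change _ * J ν = _
  rw [hinv, Finset.mul_sum, Finset.mul_sum]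
  refine Finset.sum_congr rfl fun μ _ => ?_
  rw [hsum, RChi_eq, ← Matrix.transpose_nonsing_inv, Matrix.transpose_apply]
  have hg := Gamma_prod s hs μ
  linear_combination ((A⁻¹ ν μ : ℝ) : ℂ) * Complex.I *
    (∫ t, GG x y (Matrix.vecMul t A) * K' μ t) * hg

end
end

section
/- Let r ≥ 1, χ : {1,…,r} → {0,1}, A ∈ GL_r(ℝ), x, y ∈ (0,1)^r, and let k = (k_1,…,k_r) ∈ ℤ_{>0}^r satisfy k_ν ≡ χ(ν) (mod 2) for every ν. Then L_χ(k, A, x, y) = |det A|^{−1} e(−x·y) B_{k−1}(A*, y, 1−x) · (2πi)^{k_1+⋯+k_r} / (2^r ∏_{ν=1}^r (k_ν−1)!), where A* = (Aᵀ)^{−1}, k−1 = (k_1−1,…,k_r−1), and 1−x = (1−x_1,…,1−x_r). -/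
open MeasureTheory

noncomputable section

/-- the partial derivative in the ν-th coordinate -/
def pder {r : ℕ} (ν : Fin r) (g : (Fin r → ℝ) → ℂ) : (Fin r → ℝ) → ℂ :=
  fun t => deriv (fun u : ℝ => g (Function.update t ν u)) (t ν)

/-- the iterated partial derivative `∂_{t_1}^{k_1} ⋯ ∂_{t_r}^{k_r}` -/
def pderMulti {r : ℕ} (k : Fin r → ℕ) (g : (Fin r → ℝ) → ℂ) : (Fin r → ℝ) → ℂ :=
  (List.finRange r).foldr (fun ν h => (pder ν)^[k ν] h) g

/-- the multiple Bernoulli-like numbers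
`B_k(A,x,y) = (-2π)^{-(k_1+⋯+k_r)} ∂^k F(tA,x,y)|_{t=0}` -/
def BkNum {r : ℕ} (A : Matrix (Fin r) (Fin r) ℝ) (x y : Fin r → ℝ)
    (k : Fin r → ℕ) : ℂ :=
  ((-2 * (Real.pi : ℂ)) ^ (∑ ν, k ν))⁻¹ *
    pderMulti k (fun t => FF (Matrix.vecMul t A) x y) 0

lemma int_gammaR {s c : ℝ} (hs : 0 < s) (hc : 0 < c) :
    IntegrableOn (fun t : ℝ => t ^ (s - 1) * Real.exp (-(c * t))) (Set.Ioi 0) := by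
  have := integrableOn_rpow_mul_exp_neg_mul_rpow (p := 1) (s := s - 1) (b := c) (by linarith)
    one_pos hc
  simpa using this

lemma norm_gamma_integrand {z b : ℂ} {t : ℝ} (ht : 0 < t) :
    ‖(t : ℂ) ^ (z - 1) * Complex.exp (-(b * t))‖ = t ^ (z.re - 1) * Real.exp (-(b.re * t)) := by
  rw [norm_mul, Complex.norm_cpow_eq_rpow_re_of_pos ht, Complex.norm_exp]
  simp

lemma meas_gammaC (z b : ℂ) :
    AEStronglyMeasurable (fun t : ℝ => (t : ℂ) ^ (z - 1) * Complex.exp (-(b * t)))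
      (volume.restrict (Set.Ioi 0)) := by
  apply Measurable.aestronglyMeasurable
  fun_prop

lemma int_gammaC {z b : ℂ} (hz : 0 < z.re) (hb : 0 < b.re) :
    IntegrableOn (fun t : ℝ => (t : ℂ) ^ (z - 1) * Complex.exp (-(b * t))) (Set.Ioi 0) := by
  refine Integrable.mono' (int_gammaR hz hb) (meas_gammaC z b) ?_
  filter_upwards [ae_restrict_mem measurableSet_Ioi] with t ht
  rw [norm_gamma_integrand ht]

lemma gamma_diff {z b : ℂ} (hz : 0 < z.re) (hb : 0 < b.re) :
    DifferentiableAt ℂ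
      (fun b : ℂ => ∫ t in Set.Ioi (0 : ℝ), (t : ℂ) ^ (z - 1) * Complex.exp (-(b * t))) b := by
  have hb2 : 0 < b.re / 2 := by linarith
  have key := hasDerivAt_integral_of_dominated_loc_of_deriv_le
    (μ := volume.restrict (Set.Ioi (0 : ℝ))) (x₀ := b) (s := {w : ℂ | b.re / 2 < w.re})
    (F := fun (b : ℂ) (t : ℝ) => (t : ℂ) ^ (z - 1) * Complex.exp (-(b * t)))
    (F' := fun (b : ℂ) (t : ℝ) => (t : ℂ) ^ (z - 1) * (Complex.exp (-(b * t)) * (-t)))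
    (bound := fun t => t ^ (z.re + 1 - 1) * Real.exp (-(b.re / 2 * t)))
    ((isOpen_lt continuous_const Complex.continuous_re).mem_nhds (by
      show b.re / 2 < b.re
      linarith))
    (Filter.Eventually.of_forall fun w => meas_gammaC z w) (int_gammaC hz hb)
    (by
      apply Measurable.aestronglyMeasurable
      fun_prop) ?_ (int_gammaR (by linarith) hb2) ?_
  · exact key.2.differentiableAt
  · filter_upwards [ae_restrict_mem measurableSet_Ioi] with t ht w hw
    have ht' : (0 : ℝ) < t := ht
    have hw' : b.re / 2 < w.re := hw
    rw [← mul_assoc, norm_mul, norm_gamma_integrand ht', norm_neg, Complex.norm_real,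
      Real.norm_of_nonneg ht'.le]
    have h1 : t ^ (z.re + 1 - 1) = t ^ (z.re - 1) * t := by
      rw [← Real.rpow_add_one ht'.ne']
      congr 1; ring
    rw [h1, mul_right_comm]
    gcongr
  · filter_upwards with t w hw
    have h1 : HasDerivAt (fun w : ℂ => -(w * (t : ℂ))) (-(t : ℂ)) w := by
      have h0 := ((hasDerivAt_id' w).mul_const (t : ℂ)).fun_neg
      rwa [one_mul] at h0
    exact (h1.cexp).const_mul _

lemma gamma_rot {z b : ℂ} (hz : 0 < z.re) (hb : 0 < b.re) :
    ∫ t in Set.Ioi (0 : ℝ), (t : ℂ) ^ (z - 1) * Complex.exp (-(b * t))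
      = b ^ (-z) * Complex.Gamma z := by
  set U : Set ℂ := {w : ℂ | 0 < w.re} with hU
  have hUo : IsOpen U := isOpen_lt continuous_const Complex.continuous_re
  have hUc : IsPreconnected U := (convex_halfSpace_re_gt 0).isPreconnected
  have hf : AnalyticOnNhd ℂ
      (fun b : ℂ => ∫ t in Set.Ioi (0 : ℝ), (t : ℂ) ^ (z - 1) * Complex.exp (-(b * t))) U :=
    DifferentiableOn.analyticOnNhd
      (fun w hw => (gamma_diff hz hw).differentiableWithinAt) hUo
  have hg : AnalyticOnNhd ℂ (fun b : ℂ => b ^ (-z) * Complex.Gamma z) U := by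
    refine DifferentiableOn.analyticOnNhd (fun w hw => ?_) hUo
    have : DifferentiableAt ℂ (fun b : ℂ => b ^ (-z) * Complex.Gamma z) w :=
      (differentiableAt_id.cpow_const (Or.inl hw)).mul_const _
    exact this.differentiableWithinAt
  refine hf.eqOn_of_preconnected_of_frequently_eq hg hUc (z₀ := 1) (by simp [hU]) ?_ hb
  have ht : Filter.Tendsto (fun n : ℕ => ((1 + 1 / ((n : ℝ) + 1) : ℝ) : ℂ)) Filter.atTop
      (nhdsWithin 1 {1}ᶜ) := by
    refine tendsto_nhdsWithin_iff.2 ⟨?_, Filter.Eventually.of_forall fun n => ?_⟩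
    · have h1 : Filter.Tendsto (fun n : ℕ => (1 + 1 / ((n : ℝ) + 1) : ℝ)) Filter.atTop
          (nhds (1 + 0)) := tendsto_const_nhds.add tendsto_one_div_add_atTop_nhds_zero_nat
      have h2 := (Complex.continuous_ofReal.tendsto _).comp h1
      simpa [Function.comp_def] using h2
    · have : (0 : ℝ) < 1 / ((n : ℝ) + 1) := by positivity
      simp only [Set.mem_compl_iff, Set.mem_singleton_iff]
      intro h
      have h' : (1 + 1 / ((n : ℝ) + 1) : ℝ) = 1 := by exact_mod_cast h
      linarith
  refine ht.frequently (Filter.Frequently.of_forall fun n => ?_)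
  have hr : (0 : ℝ) < 1 + 1 / ((n : ℝ) + 1) := by positivity
  generalize (1 + 1 / ((n : ℝ) + 1) : ℝ) = r at hr
  have := Complex.integral_cpow_mul_exp_neg_mul_Ioi hz hr
  rw [this, one_div, Complex.inv_cpow, Complex.cpow_neg]
  rw [Complex.arg_ofReal_of_nonneg hr.le]
  exact Real.pi_ne_zero.symm

lemma real_mul_cpow {s : ℝ} {b w : ℂ} (hs : 0 < s) (hb : b ≠ 0) :
    ((s : ℂ) * b) ^ w = (s : ℂ) ^ w * b ^ w := by
  have hs' : (s : ℂ) ≠ 0 := by exact_mod_cast hs.ne'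
  rw [Complex.cpow_def_of_ne_zero (mul_ne_zero hs' hb), Complex.cpow_def_of_ne_zero hs',
    Complex.cpow_def_of_ne_zero hb, Complex.log_ofReal_mul hs hb, ← Complex.exp_add,
    Complex.ofReal_log hs.le]
  congr 1; ring

/-- the key Mellin transform -/
lemma mellin_key {z a b : ℂ} (hz : 0 < z.re) (hz1 : z.re < 1) (ha : 0 < a.re) (hb : 0 < b.re) :
    ∫ v in Set.Ioi (0 : ℝ), (v : ℂ) ^ (z - 1) * (a + b * v)⁻¹
      = (b ^ (-z) * Complex.Gamma z) * (a ^ (z - 1) * Complex.Gamma (1 - z)) := by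
  have hz1' : 0 < (1 - z).re := by simpa using hz1
  -- inner exponential integral
  have h1 : ∀ v ∈ Set.Ioi (0 : ℝ), (v : ℂ) ^ (z - 1) * (a + b * v)⁻¹ =
      ∫ s in Set.Ioi (0 : ℝ), (v : ℂ) ^ (z - 1) * Complex.exp (-((a + b * v) * s)) := by
    intro v hv
    have hv' : (0 : ℝ) < v := hv
    have hre : 0 < (a + b * v).re := by
      simp only [Complex.add_re, Complex.re_mul_ofReal]
      positivity
    rw [integral_const_mul]
    congr 1
    have := gamma_rot (z := 1) (b := a + b * v) (by simp) hre
    simp only [sub_self, Complex.cpow_zero, one_mul, Complex.Gamma_one, mul_one,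
      Complex.cpow_neg_one] at this
    exact this.symm
  rw [setIntegral_congr_fun measurableSet_Ioi h1]
  have hint : Integrable (Function.uncurry fun (v s : ℝ) =>
      (v : ℂ) ^ (z - 1) * Complex.exp (-((a + b * v) * s)))
      ((volume.restrict (Set.Ioi (0 : ℝ))).prod (volume.restrict (Set.Ioi (0 : ℝ)))) := by
    have hm : Measurable (Function.uncurry fun (v s : ℝ) =>
      (v : ℂ) ^ (z - 1) * Complex.exp (-((a + b * v) * s))) := by
      unfold Function.uncurry
      fun_prop
    refine (integrable_prod_iff' hm.aestronglyMeasurable).2 ⟨?_, ?_⟩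
    · filter_upwards [ae_restrict_mem measurableSet_Ioi] with s hs
      have hs' : (0 : ℝ) < s := hs
      have h2 := (int_gammaC (z := z) (b := b * s) hz (by
        simp only [Complex.re_mul_ofReal]; positivity)).mul_const (Complex.exp (-(a * s)))
      refine h2.congr (Filter.Eventually.of_forall fun v => ?_)
      simp only [Function.uncurry]
      rw [mul_assoc, ← Complex.exp_add]
      congr 2; ring
    · have h3 : IntegrableOn (fun s : ℝ => (b.re ^ (-z.re) * Real.Gamma z.re) *
          (s ^ ((1 - z.re) - 1) * Real.exp (-(a.re * s)))) (Set.Ioi 0) :=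
        (int_gammaR (by linarith) ha).const_mul _
      refine h3.congr ?_
      filter_upwards [ae_restrict_mem measurableSet_Ioi] with s hs
      have hs' : (0 : ℝ) < s := hs
      have h4 : ∀ v ∈ Set.Ioi (0 : ℝ), ‖(v : ℂ) ^ (z - 1) * Complex.exp (-((a + b * v) * s))‖
          = Real.exp (-(a.re * s)) * (v ^ (z.re - 1) * Real.exp (-((b.re * s) * v))) := by
        intro v hv
        rw [norm_mul, Complex.norm_cpow_eq_rpow_re_of_pos hv, Complex.norm_exp,
          mul_left_comm, ← Real.exp_add]
        congr 2
        simp; ring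
      have h5 := Real.integral_rpow_mul_exp_neg_mul_Ioi (a := z.re) (r := b.re * s) hz
        (by positivity)
      simp only [Function.uncurry]
      rw [setIntegral_congr_fun measurableSet_Ioi h4, integral_const_mul, h5, one_div,
        Real.inv_rpow (by positivity), ← Real.rpow_neg (by positivity),
        Real.mul_rpow hb.le hs'.le]
      have : (1 - z.re - 1) = -z.re := by ring
      rw [this]; ring
  rw [integral_integral_swap hint]
  have h6 : ∀ s ∈ Set.Ioi (0 : ℝ),
      (∫ v in Set.Ioi (0 : ℝ), (v : ℂ) ^ (z - 1) * Complex.exp (-((a + b * v) * s))) =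
      (b ^ (-z) * Complex.Gamma z) * ((s : ℂ) ^ ((1 - z) - 1) * Complex.exp (-(a * s))) := by
    intro s hs
    have hs' : (0 : ℝ) < s := hs
    have h7 := gamma_rot (z := z) (b := b * s) hz (by
        simp only [Complex.re_mul_ofReal]; positivity)
    have h8 : ∀ v : ℝ, (v : ℂ) ^ (z - 1) * Complex.exp (-((a + b * v) * s)) =
        Complex.exp (-(a * s)) * ((v : ℂ) ^ (z - 1) * Complex.exp (-((b * s) * v))) := by
      intro v
      rw [mul_left_comm, ← Complex.exp_add]
      congr 2; ring
    simp_rw [h8]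
    rw [integral_const_mul, h7, mul_comm b, real_mul_cpow hs' (fun h => by simp [h] at hb)]
    have : (1 - z - 1) = -z := by ring
    rw [this]; ring
  rw [setIntegral_congr_fun measurableSet_Ioi h6, integral_const_mul,
    gamma_rot hz1' ha, neg_sub]
lemma exp_int_mellin (f : ℝ → ℂ) (z : ℂ) :
    ∫ v in Set.Ioi (0 : ℝ), (v : ℂ) ^ (z - 1) * f v
      = ∫ u : ℝ, Complex.exp (-z * u) * f (Real.exp (-u)) := by
  have him : (fun x : ℝ => Real.exp (-x)) '' Set.univ = Set.Ioi 0 := by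
    ext v
    simp only [Set.image_univ, Set.mem_range, Set.mem_Ioi]
    constructor
    · rintro ⟨w, rfl⟩
      exact Real.exp_pos _
    · intro hv
      exact ⟨-Real.log v, by rw [neg_neg, Real.exp_log hv]⟩
  have hder : ∀ x ∈ Set.univ, HasDerivWithinAt (fun x : ℝ => Real.exp (-x))
      (-Real.exp (-x)) Set.univ x := by
    intro x _
    have := ((hasDerivAt_neg x).exp).hasDerivWithinAt (s := Set.univ)
    simpa using this
  have hinj : Set.univ.InjOn (fun x : ℝ => Real.exp (-x)) := by
    intro p _ q _ h
    exact neg_injective (Real.exp_injective h)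
  rw [← him, integral_image_eq_integral_abs_deriv_smul MeasurableSet.univ hder hinj,
    Measure.restrict_univ]
  congr 1
  ext u
  rw [abs_neg, abs_of_pos (Real.exp_pos _), Complex.real_smul, ← mul_assoc]
  congr 1
  rw [Complex.ofReal_exp, Complex.cpow_def_of_ne_zero (Complex.exp_ne_zero _),
    Complex.log_exp (by simp [Real.pi_pos]) (by simp [Real.pi_pos.le]), ← Complex.exp_add]
  congr 1
  push_cast
  ring

/-- `α = π (y - 1/2)` -/
def alp (y : ℝ) : ℝ := Real.pi * (y - 1 / 2)

lemma alp_re_pos {y : ℝ} (hy : y ∈ Set.Ioo (0 : ℝ) 1) : 0 < Real.cos (alp y) := by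
  apply Real.cos_pos_of_mem_Ioo
  unfold alp
  constructor <;> nlinarith [Real.pi_pos, hy.1, hy.2]

lemma expI_re (θ : ℝ) : (Complex.exp (θ * Complex.I)).re = Real.cos θ :=
  Complex.exp_ofReal_mul_I_re θ

lemma denom_eq (y : ℝ) (w : ℂ) :
    Complex.exp (((-alp y : ℝ) : ℂ) * Complex.I) * (1 - Complex.exp (2 * Real.pi * Complex.I * y) * w)
      = Complex.exp (((-alp y : ℝ) : ℂ) * Complex.I) + Complex.exp ((alp y : ℂ) * Complex.I) * w := by
  have h : Complex.exp (((-alp y : ℝ) : ℂ) * Complex.I) * Complex.exp (2 * Real.pi * Complex.I * y)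
      = - Complex.exp ((alp y : ℂ) * Complex.I) := by
    rw [← Complex.exp_add]
    have : (((-alp y : ℝ) : ℂ) * Complex.I) + 2 * Real.pi * Complex.I * y
      = (alp y : ℂ) * Complex.I + Real.pi * Complex.I := by
      unfold alp; push_cast; ring
    rw [this, Complex.exp_add, Complex.exp_pi_mul_I]; ring
  linear_combination (-w) * h

lemma expI_cpow {θ : ℝ} (h1 : -Real.pi < θ) (h2 : θ ≤ Real.pi) (w : ℂ) :
    Complex.exp ((θ : ℂ) * Complex.I) ^ w = Complex.exp (θ * Complex.I * w) := by
  rw [Complex.cpow_def_of_ne_zero (Complex.exp_ne_zero _), Complex.log_exp (by simpa) (by simpa)]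

lemma eC_denom (y t : ℝ) : eC (y + Complex.I * t) =
    Complex.exp (2 * Real.pi * Complex.I * y) * Real.exp (-(2 * Real.pi * t)) := by
  unfold eC
  rw [Complex.ofReal_exp, ← Complex.exp_add]
  congr 1
  push_cast
  linear_combination (2 * Real.pi * t : ℂ) * Complex.I_mul_I

lemma denom_re_pos (y v : ℝ) :
    Real.cos (alp y) * (1 + v) ≤ ‖1 - Complex.exp (2 * Real.pi * Complex.I * y) * v‖ := by
  have h := congrArg norm (denom_eq y v)
  rw [norm_mul, Complex.norm_exp_ofReal_mul_I, one_mul] at h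
  rw [h]
  refine le_trans (le_of_eq ?_) (Complex.re_le_norm _)
  rw [Complex.add_re, Complex.re_mul_ofReal, expI_re, expI_re, Real.cos_neg]
  ring

lemma sin_id {z : ℂ} (hz : 0 < z.re) (hz1 : z.re < 1) (y : ℝ) :
    Complex.exp (-(2 * alp y * Complex.I * z)) * (2 * Complex.sin (Real.pi * z))⁻¹ =
      Complex.I * Complex.exp (-(2 * Real.pi * Complex.I * y * z)) /
        (1 - Complex.exp (-(2 * Real.pi * Complex.I * z))) := by
  have hs : Complex.sin (Real.pi * z) ≠ 0 := by
    intro h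
    rw [Complex.sin_eq_zero_iff] at h
    obtain ⟨k, hk⟩ := h
    have hk' : z = k := by
      have : (Real.pi : ℂ) ≠ 0 := by exact_mod_cast Real.pi_ne_zero
      apply mul_left_cancel₀ this
      rw [hk]; ring
    rw [hk'] at hz hz1
    simp at hz hz1
    have h1 : (0 : ℤ) < k := by exact_mod_cast hz
    have h2 : k < (1 : ℤ) := by exact_mod_cast hz1
    omega
  set E := Complex.exp (Real.pi * z * Complex.I) with hE
  have hE0 : E ≠ 0 := Complex.exp_ne_zero _
  have h1 : Complex.exp (-(2 * alp y * Complex.I * z)) =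
      Complex.exp (-(2 * Real.pi * Complex.I * y * z)) * E := by
    rw [hE, ← Complex.exp_add]; congr 1; unfold alp; push_cast; ring
  have h2 : 2 * Complex.sin (Real.pi * z) = (E⁻¹ - E) * Complex.I := by
    rw [Complex.two_sin, hE, ← Complex.exp_neg, neg_mul]
  have h3 : Complex.exp (-(2 * Real.pi * Complex.I * z)) = E⁻¹ * E⁻¹ := by
    rw [hE, ← Complex.exp_neg, ← Complex.exp_add]; congr 1; ring
  have h4 : (E⁻¹ - E) ≠ 0 := by
    intro h
    rw [h] at h2
    apply hs
    linear_combination h2 / 2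
  have h5 : (1 - E⁻¹ * E⁻¹) ≠ 0 := by
    intro h
    apply h4
    have : E⁻¹ - E = -E * (1 - E⁻¹ * E⁻¹) := by field_simp; ring
    rw [this, h, mul_zero]
  rw [h1, h2, h3, eq_div_iff h5, mul_inv, Complex.inv_I]
  have : (1 - E⁻¹ * E⁻¹) = -(E⁻¹ - E) * E⁻¹ := by field_simp; ring
  rw [this]
  generalize (E⁻¹ - E) = D at h4
  field_simp

lemma FT1 {x y : ℝ} (hx : x ∈ Set.Ioo (0 : ℝ) 1) (hy : y ∈ Set.Ioo (0 : ℝ) 1) (u : ℝ) :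
    ∫ t : ℝ, phiF t x y * Complex.exp (2 * Real.pi * Complex.I * (t * u)) =
      Complex.I * eC (-((x * y : ℝ) : ℂ)) * phiF u y (1 - x) := by
  set z : ℂ := x - Complex.I * u with hz
  have hzre : z.re = x := by simp [hz]
  have hz0 : 0 < z.re := by rw [hzre]; exact hx.1
  have hz1 : z.re < 1 := by rw [hzre]; exact hx.2
  set a := Complex.exp (((-alp y : ℝ) : ℂ) * Complex.I) with ha
  set b := Complex.exp ((alp y : ℂ) * Complex.I) with hb
  have hare : 0 < a.re := by rw [ha, expI_re, Real.cos_neg]; exact alp_re_pos hy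
  have hbre : 0 < b.re := by rw [hb, expI_re]; exact alp_re_pos hy
  have ha0 : a ≠ 0 := Complex.exp_ne_zero _
  have hal1 : -Real.pi < alp y := by unfold alp; nlinarith [Real.pi_pos, hy.1, hy.2]
  have hal2 : alp y < Real.pi := by unfold alp; nlinarith [Real.pi_pos, hy.1, hy.2]
  have hpi : (Real.pi : ℂ) ≠ 0 := by exact_mod_cast Real.pi_ne_zero
  have h1 : ∀ t : ℝ, phiF t x y * Complex.exp (2 * Real.pi * Complex.I * (t * u)) =
      a * (fun s : ℝ => Complex.exp (-z * s) * (a + b * (Real.exp (-s) : ℝ))⁻¹)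
        (2 * Real.pi * t) := by
    intro t
    simp only
    rw [← denom_eq, phiF, eC_denom, mul_inv, div_eq_mul_inv, mul_right_comm]
    have : eC (Complex.I * t * x) * Complex.exp (2 * Real.pi * Complex.I * (t * u)) =
        Complex.exp (-z * ((2 * Real.pi * t : ℝ) : ℂ)) := by
      rw [eC, ← Complex.exp_add]
      congr 1
      rw [hz]; push_cast
      linear_combination (2 * Real.pi * t * x : ℂ) * Complex.I_mul_I
    rw [this, ← ha]
    field_simp
  rw [integral_congr_ae (Filter.Eventually.of_forall h1), integral_const_mul,
    Measure.integral_comp_mul_left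
      (fun s : ℝ => Complex.exp (-z * s) * (a + b * (Real.exp (-s) : ℝ))⁻¹) (2 * Real.pi),
    ← exp_int_mellin (fun v => (a + b * v)⁻¹) z, mellin_key hz0 hz1 hare hbre,
    abs_of_pos (by have := Real.pi_pos; positivity), Complex.real_smul]
  have hG := Complex.Gamma_mul_Gamma_one_sub z
  have hbz : b ^ (-z) = Complex.exp (-(alp y * Complex.I * z)) := by
    rw [hb, expI_cpow hal1 hal2.le]; congr 1; ring
  have haz : a ^ (z - 1) * a = Complex.exp (-(alp y * Complex.I * z)) := by
    nth_rewrite 2 [← Complex.cpow_one a]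
    rw [← Complex.cpow_add _ _ ha0, ha, expI_cpow (by linarith) (by linarith)]
    congr 1; push_cast; ring
  have hprod : Complex.exp (-(alp y * Complex.I * z)) * Complex.exp (-(alp y * Complex.I * z)) =
      Complex.exp (-(2 * alp y * Complex.I * z)) := by
    rw [← Complex.exp_add]; congr 1; ring
  calc a * ((((2 * Real.pi)⁻¹ : ℝ) : ℂ) *
        ((b ^ (-z) * Complex.Gamma z) * (a ^ (z - 1) * Complex.Gamma (1 - z))))
      = (2 * Real.pi : ℂ)⁻¹ * (b ^ (-z) * (a ^ (z - 1) * a)) *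
          (Complex.Gamma z * Complex.Gamma (1 - z)) := by push_cast; ring
    _ = Complex.exp (-(2 * alp y * Complex.I * z)) * (2 * Complex.sin (Real.pi * z))⁻¹ := by
        rw [hG, hbz, haz, hprod, mul_inv, mul_inv]
        field_simp
    _ = _ := by
        rw [sin_id hz0 hz1, phiF, eC_denom, eC, eC, div_eq_mul_inv, div_eq_mul_inv]
        have e1 : Complex.exp (-(2 * Real.pi * Complex.I * z)) =
            Complex.exp (2 * Real.pi * Complex.I * ((1 - x : ℝ) : ℂ)) *
              (Real.exp (-(2 * Real.pi * u)) : ℝ) := by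
          rw [Complex.ofReal_exp, ← Complex.exp_add,
            ← mul_one (Complex.exp (-(2 * Real.pi * Complex.I * z))), ← Complex.exp_two_pi_mul_I,
            ← Complex.exp_add]
          congr 1
          rw [hz]; push_cast
          linear_combination (2 * Real.pi * u : ℂ) * Complex.I_mul_I
        have e2 : Complex.exp (-(2 * Real.pi * Complex.I * y * z)) =
            Complex.exp (2 * Real.pi * Complex.I * -((x * y : ℝ) : ℂ)) *
              Complex.exp (2 * Real.pi * Complex.I * (Complex.I * u * y)) := by
          rw [← Complex.exp_add]
          congr 1
          rw [hz]; push_cast; ring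
        rw [e1, e2]; ring

lemma phiF_continuous {x y : ℝ} (hy : y ∈ Set.Ioo (0 : ℝ) 1) :
    Continuous (fun t : ℝ => phiF t x y) := by
  unfold phiF
  refine Continuous.div (by unfold eC; fun_prop) (by unfold eC; fun_prop) ?_
  intro t h
  rw [eC_denom] at h
  have h1 := denom_re_pos y (Real.exp (-(2 * Real.pi * t)))
  rw [h, norm_zero] at h1
  have := mul_pos (alp_re_pos hy) (add_pos one_pos (Real.exp_pos (-(2 * Real.pi * t))))
  linarith

lemma phiF_bound {x y : ℝ} (hy : y ∈ Set.Ioo (0 : ℝ) 1) (t : ℝ) :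
    ‖phiF t x y‖ ≤ (Real.cos (alp y))⁻¹ * Real.exp (-(2 * Real.pi * min x (1 - x) * |t|)) := by
  have hc := alp_re_pos hy
  have h1 := denom_re_pos y (Real.exp (-(2 * Real.pi * t)))
  have hn : ‖eC (Complex.I * t * x)‖ = Real.exp (-(2 * Real.pi * t * x)) := by
    unfold eC
    rw [Complex.norm_exp]
    congr 1
    simp; ring
  rw [phiF, eC_denom, norm_div, hn, div_le_iff₀ (lt_of_lt_of_le (by positivity) h1)]
  refine le_trans ?_ (mul_le_mul_of_nonneg_left h1 (by positivity))
  have h2 : (Real.cos (alp y))⁻¹ * Real.exp (-(2 * Real.pi * min x (1 - x) * |t|)) *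
      (Real.cos (alp y) * (1 + Real.exp (-(2 * Real.pi * t)))) =
      Real.exp (-(2 * Real.pi * min x (1 - x) * |t|)) * 1 +
      Real.exp (-(2 * Real.pi * min x (1 - x) * |t|)) * Real.exp (-(2 * Real.pi * t)) := by
    field_simp
  rw [h2, ← Real.exp_add, mul_one]
  have hm1 := min_le_left x (1 - x)
  have hm2 := min_le_right x (1 - x)
  have hpi := Real.pi_pos
  rcases le_total 0 t with ht | ht
  · have : Real.exp (-(2 * Real.pi * t * x)) ≤ Real.exp (-(2 * Real.pi * min x (1 - x) * |t|)) := by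
      apply Real.exp_le_exp.2
      rw [abs_of_nonneg ht]
      have := mul_le_mul_of_nonneg_left hm1 (by positivity : 0 ≤ 2 * Real.pi * t)
      linarith
    linarith [Real.exp_pos (-(2 * Real.pi * min x (1 - x) * |t|) + -(2 * Real.pi * t))]
  · have : Real.exp (-(2 * Real.pi * t * x)) ≤
        Real.exp (-(2 * Real.pi * min x (1 - x) * |t|) + -(2 * Real.pi * t)) := by
      apply Real.exp_le_exp.2
      rw [abs_of_nonpos ht]
      have := mul_le_mul_of_nonneg_left hm2 (by nlinarith : 0 ≤ 2 * Real.pi * (-t))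
      linarith
    linarith [Real.exp_pos (-(2 * Real.pi * min x (1 - x) * |t|))]

lemma int_poly_exp {c : ℝ} (hc : 0 < c) (N : ℕ) :
    Integrable (fun t : ℝ => (1 + |t|) ^ N * Real.exp (-(c * |t|))) := by
  have h0 : IntegrableOn (fun t : ℝ => (1 + t) ^ N * Real.exp (-(c * t))) (Set.Ioi 0) := by
    simp_rw [add_comm (1 : ℝ), add_pow, Finset.sum_mul]
    refine integrable_finsetSum _ fun i _ => ?_
    have := (int_gammaR (s := (i : ℝ) + 1) (by positivity) hc).mul_const ((N.choose i : ℝ))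
    refine this.congr (Filter.Eventually.of_forall fun t => ?_)
    simp only [add_sub_cancel_right, Real.rpow_natCast, one_pow]
    ring
  have h1 : IntegrableOn (fun t : ℝ => (1 + |t|) ^ N * Real.exp (-(c * |t|))) (Set.Ioi 0) := by
    refine h0.congr_fun (fun t ht => ?_) measurableSet_Ioi
    rw [Set.mem_Ioi] at ht
    simp only [abs_of_pos ht]
  have h2 : IntegrableOn (fun t : ℝ => (1 + |t|) ^ N * Real.exp (-(c * |t|))) (Set.Iic 0) := by
    rw [← integrableOn_Ici_iff_integrableOn_Ioi] at h1
    have h3 := IntegrableOn.comp_neg_Iic (c := (0 : ℝ)) (by rw [neg_zero]; exact h1)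
    simpa only [abs_neg] using h3
  have h4 := h2.union h1
  rwa [Set.Iic_union_Ioi, integrableOn_univ] at h4

lemma phiF_int {x y : ℝ} (hx : x ∈ Set.Ioo (0 : ℝ) 1) (hy : y ∈ Set.Ioo (0 : ℝ) 1) (N : ℕ) :
    Integrable (fun t : ℝ => (1 + |t|) ^ N * ‖phiF t x y‖) := by
  have hm : 0 < min x (1 - x) := lt_min hx.1 (by linarith [hx.2])
  have h := (int_poly_exp (c := 2 * Real.pi * min x (1 - x))
    (by have := Real.pi_pos; positivity) N).const_mul (Real.cos (alp y))⁻¹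
  refine h.mono' ?_ (Filter.Eventually.of_forall fun t => ?_)
  · have := phiF_continuous (x := x) hy
    exact (by fun_prop : Continuous (fun t : ℝ => (1 + |t|) ^ N * ‖phiF t x y‖)).aestronglyMeasurable
  · rw [Real.norm_of_nonneg (by positivity)]
    have := mul_le_mul_of_nonneg_left (phiF_bound (x := x) hy t) (by positivity : 0 ≤ (1 + |t|) ^ N)
    linarith


/-- continuous functions all of whose polynomial multiples are integrable -/
def RD {r : ℕ} (h : (Fin r → ℝ) → ℂ) : Prop :=
  Continuous h ∧ ∀ N : ℕ, Integrable (fun t => (1 + ‖t‖) ^ N * ‖h t‖)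

/-- multiplication by `2πi t_ν` -/
def mulc {r : ℕ} (ν : Fin r) (h : (Fin r → ℝ) → ℂ) : (Fin r → ℝ) → ℂ :=
  fun t => (2 * Real.pi * Complex.I * t ν) * h t

/-- the Fourier integral -/
def JJ {r : ℕ} (h : (Fin r → ℝ) → ℂ) : (Fin r → ℝ) → ℂ :=
  fun u => ∫ t, h t * Complex.exp (2 * Real.pi * Complex.I * ((∑ μ, t μ * u μ : ℝ) : ℂ))

lemma norm_mulc_le {r : ℕ} (ν : Fin r) (h : (Fin r → ℝ) → ℂ) (t : Fin r → ℝ) :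
    ‖mulc ν h t‖ ≤ 2 * Real.pi * ((1 + ‖t‖) * ‖h t‖) := by
  unfold mulc
  have hpi := Real.pi_pos
  have : ‖(2 * Real.pi * Complex.I * t ν : ℂ)‖ = 2 * Real.pi * ‖t ν‖ := by
    simp [abs_of_pos hpi]
  rw [norm_mul, this, mul_assoc]
  have h1 : ‖t ν‖ ≤ 1 + ‖t‖ := by linarith [norm_le_pi_norm t ν]
  gcongr

lemma RD.mulc {r : ℕ} {h : (Fin r → ℝ) → ℂ} (hh : RD h) (ν : Fin r) : RD (mulc ν h) := by
  have hc := hh.1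
  have hc' : Continuous (_root_.mulc ν h) := by unfold _root_.mulc; fun_prop
  refine ⟨hc', fun N => ?_⟩
  refine ((hh.2 (N + 1)).const_mul (2 * Real.pi)).mono' (by fun_prop)
    (Filter.Eventually.of_forall fun t => ?_)
  rw [Real.norm_of_nonneg (by positivity)]
  have := mul_le_mul_of_nonneg_left (norm_mulc_le ν h t) (by positivity : 0 ≤ (1 + ‖t‖) ^ N)
  rw [pow_succ]
  linarith

lemma RD.integrable {r : ℕ} {h : (Fin r → ℝ) → ℂ} (hh : RD h) : Integrable h := by
  refine (hh.2 0).mono' hh.1.aestronglyMeasurable (Filter.Eventually.of_forall fun t => ?_)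
  simp

lemma norm_exp_2pi (s : ℝ) : ‖Complex.exp (2 * Real.pi * Complex.I * (s : ℂ))‖ = 1 := by
  rw [Complex.norm_exp]; simp

lemma sum_update {r : ℕ} (t u : Fin r → ℝ) (ν : Fin r) (s : ℝ) :
    ∑ μ, t μ * Function.update u ν s μ = t ν * s + ∑ μ ∈ Finset.univ.erase ν, t μ * u μ := by
  rw [← Finset.add_sum_erase _ _ (Finset.mem_univ ν), Function.update_self]
  congr 1
  refine Finset.sum_congr rfl fun μ hμ => ?_
  rw [Function.update_of_ne (Finset.ne_of_mem_erase hμ)]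

lemma pder_JJ {r : ℕ} {h : (Fin r → ℝ) → ℂ} (hh : RD h) (ν : Fin r) :
    pder ν (JJ h) = JJ (mulc ν h) := by
  funext u
  have hc := hh.1
  have hm := (hh.mulc ν)
  have hmc := hm.1
  have key := hasDerivAt_integral_of_dominated_loc_of_deriv_le
    (μ := (volume : Measure (Fin r → ℝ))) (x₀ := u ν) (s := Set.univ)
    (F := fun (s : ℝ) (t : Fin r → ℝ) => h t * Complex.exp (2 * Real.pi * Complex.I *
      ((∑ μ, t μ * Function.update u ν s μ : ℝ) : ℂ)))
    (F' := fun (s : ℝ) (t : Fin r → ℝ) => mulc ν h t * Complex.exp (2 * Real.pi * Complex.I *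
      ((∑ μ, t μ * Function.update u ν s μ : ℝ) : ℂ)))
    (bound := fun t => ‖mulc ν h t‖) Filter.univ_mem
    (Filter.Eventually.of_forall fun s => Continuous.aestronglyMeasurable (by fun_prop))
    (by
      refine hh.integrable.norm.mono' (Continuous.aestronglyMeasurable (by fun_prop))
        (Filter.Eventually.of_forall fun t => ?_)
      rw [norm_mul, norm_exp_2pi, mul_one])
    (Continuous.aestronglyMeasurable (by fun_prop))
    (Filter.Eventually.of_forall fun t s _ => by rw [norm_mul, norm_exp_2pi, mul_one])
    hm.integrable.norm
    (Filter.Eventually.of_forall fun t s _ => by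
      have h1 : HasDerivAt (fun s : ℝ => 2 * Real.pi * Complex.I *
          ((∑ μ, t μ * Function.update u ν s μ : ℝ) : ℂ)) (2 * Real.pi * Complex.I * t ν) s := by
        simp_rw [sum_update]
        have h0 : HasDerivAt (fun s : ℝ => t ν * s + ∑ μ ∈ Finset.univ.erase ν, t μ * u μ)
            (t ν) s := by
          simpa using ((hasDerivAt_id' s).const_mul (t ν)).add_const
            (∑ μ ∈ Finset.univ.erase ν, t μ * u μ)
        exact (h0.ofReal_comp).const_mul _
      convert! (h1.cexp).const_mul (h t) using 1
      unfold mulc; ring)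
  have h2 := key.2.deriv
  rw [Function.update_eq_self] at h2
  exact h2

lemma iter_mulc {r : ℕ} (ν : Fin r) (n : ℕ) (h : (Fin r → ℝ) → ℂ) :
    (mulc ν)^[n] h = fun t => (2 * Real.pi * Complex.I * t ν) ^ n * h t := by
  induction n with
  | zero => simp
  | succ n ih =>
    rw [Function.iterate_succ_apply', ih]
    funext t
    simp only [mulc]; ring

lemma RD.iter {r : ℕ} {h : (Fin r → ℝ) → ℂ} (hh : RD h) (ν : Fin r) (n : ℕ) :
    RD ((_root_.mulc ν)^[n] h) := by
  induction n with
  | zero => exact hh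
  | succ n ih =>
    rw [Function.iterate_succ_apply']
    exact ih.mulc ν

lemma pder_iter {r : ℕ} {h : (Fin r → ℝ) → ℂ} (hh : RD h) (ν : Fin r) (n : ℕ) :
    (pder ν)^[n] (JJ h) = JJ ((mulc ν)^[n] h) := by
  induction n with
  | zero => rfl
  | succ n ih =>
    rw [Function.iterate_succ_apply', Function.iterate_succ_apply', ih, pder_JJ (hh.iter ν n)]

lemma pder_fold {r : ℕ} {h : (Fin r → ℝ) → ℂ} (hh : RD h) (k : Fin r → ℕ) (l : List (Fin r)) :
    RD (fun t => (l.map fun ν => (2 * Real.pi * Complex.I * t ν) ^ k ν).prod * h t) ∧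
    l.foldr (fun ν g => (pder ν)^[k ν] g) (JJ h) =
      JJ (fun t => (l.map fun ν => (2 * Real.pi * Complex.I * t ν) ^ k ν).prod * h t) := by
  induction l with
  | nil => simpa using hh
  | cons ν l ih =>
    have e : (fun t => ((ν :: l).map fun ν => (2 * Real.pi * Complex.I * t ν) ^ k ν).prod * h t) =
        (mulc ν)^[k ν]
          (fun t => (l.map fun ν => (2 * Real.pi * Complex.I * t ν) ^ k ν).prod * h t) := by
      rw [iter_mulc]
      funext t
      simp [mul_assoc]
    rw [e]
    refine ⟨ih.1.iter ν _, ?_⟩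
    rw [List.foldr_cons, ih.2, pder_iter ih.1]

lemma pderMulti_JJ {r : ℕ} {h : (Fin r → ℝ) → ℂ} (hh : RD h) (k : Fin r → ℕ) :
    pderMulti k (JJ h) 0 = ∫ t, (∏ ν, (2 * Real.pi * Complex.I * t ν) ^ k ν) * h t := by
  unfold pderMulti
  rw [(pder_fold hh k _).2]
  unfold JJ
  simp [← List.ofFn_eq_map, List.prod_ofFn]

lemma FF_RD {r : ℕ} {x y : Fin r → ℝ} (hx : ∀ ν, x ν ∈ Set.Ioo (0 : ℝ) 1)
    (hy : ∀ ν, y ν ∈ Set.Ioo (0 : ℝ) 1) : RD (fun t => FF t x y) := by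
  have hc : Continuous (fun t : Fin r → ℝ => FF t x y) := by
    unfold FF
    exact continuous_finsetProd _ fun ν _ =>
      (phiF_continuous (hy ν)).comp (continuous_apply ν)
  refine ⟨hc, fun N => ?_⟩
  have h1 : Integrable (fun t : Fin r → ℝ => ∏ ν, ((1 + |t ν|) ^ N * ‖phiF (t ν) (x ν) (y ν)‖)) :=
    Integrable.fintype_prod (f := fun ν (s : ℝ) => (1 + |s|) ^ N * ‖phiF s (x ν) (y ν)‖)
      fun ν => phiF_int (hx ν) (hy ν) N
  refine h1.mono' (by fun_prop) (Filter.Eventually.of_forall fun t => ?_)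
  rw [Real.norm_of_nonneg (by positivity), Finset.prod_mul_distrib, Finset.prod_pow]
  simp only [FF, norm_prod]
  gcongr
  have hone : ∀ ν, 1 ≤ 1 + |t ν| := fun ν => by linarith [abs_nonneg (t ν)]
  have hprod : 1 ≤ ∏ ν, (1 + |t ν|) := by
    exact Finset.prod_induction _ (fun a => (1 : ℝ) ≤ a)
      (fun a b ha hb => one_le_mul_of_one_le_of_one_le ha hb) le_rfl fun i _ => hone i
  have : ‖t‖ ≤ (∏ ν, (1 + |t ν|)) - 1 := by
    refine (pi_norm_le_iff_of_nonneg (by linarith)).2 fun ν => ?_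
    have h2 : (1 + |t ν|) ≤ ∏ ν, (1 + |t ν|) := by
      rw [← Finset.mul_prod_erase _ _ (Finset.mem_univ ν)]
      apply le_mul_of_one_le_right (by positivity)
      exact Finset.prod_induction _ (fun a => (1 : ℝ) ≤ a)
        (fun a b ha hb => one_le_mul_of_one_le_of_one_le ha hb) le_rfl fun i _ => hone i
    rw [Real.norm_eq_abs]
    linarith
  linarith

lemma map_vecMul {r : ℕ} {A : Matrix (Fin r) (Fin r) ℝ} (hA : A.det ≠ 0) :
    Measure.map (fun t : Fin r → ℝ => Matrix.vecMul t A) volume =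
      ENNReal.ofReal |A.det⁻¹| • volume := by
  have := Real.map_matrix_volume_pi_eq_smul_volume_pi (M := A.transpose) (by simpa using hA)
  rw [Matrix.det_transpose] at this
  rw [← this]
  congr 1
  funext t
  simp [Matrix.toLin'_apply, Matrix.mulVec_transpose]

lemma cont_vecMul {r : ℕ} (A : Matrix (Fin r) (Fin r) ℝ) :
    Continuous (fun t : Fin r → ℝ => Matrix.vecMul t A) := by fun_prop

lemma RD.comp_vecMul {r : ℕ} {h : (Fin r → ℝ) → ℂ} (hh : RD h)
    {A : Matrix (Fin r) (Fin r) ℝ} (hA : A.det ≠ 0) : RD (fun t => h (Matrix.vecMul t A)) := by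
  have hc := hh.1.comp (cont_vecMul A)
  refine ⟨hc, fun N => ?_⟩
  set L : (Fin r → ℝ) →L[ℝ] (Fin r → ℝ) := LinearMap.toContinuousLinearMap (Matrix.vecMulLinear A⁻¹)
    with hL
  have hL' : ∀ t, ‖t‖ ≤ ‖L‖ * ‖Matrix.vecMul t A‖ := by
    intro t
    have h1 := L.le_opNorm (Matrix.vecMul t A)
    have h2 : L (Matrix.vecMul t A) = t := by
      simp [hL, Matrix.vecMul_vecMul, Matrix.mul_nonsing_inv A (isUnit_iff_ne_zero.2 hA)]
    rwa [h2] at h1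
  have h3 : Integrable (fun w : Fin r → ℝ => (1 + ‖L‖) ^ N * ((1 + ‖w‖) ^ N * ‖h w‖))
      (Measure.map (fun t : Fin r → ℝ => Matrix.vecMul t A) volume) := by
    rw [map_vecMul hA]
    exact ((hh.2 N).const_mul _).smul_measure ENNReal.ofReal_ne_top
  have h4 := h3.comp_measurable (cont_vecMul A).measurable
  have hc2 : Continuous (fun t : Fin r → ℝ => (1 + ‖t‖) ^ N * ‖h (Matrix.vecMul t A)‖) :=
    (by fun_prop : Continuous (fun t : Fin r → ℝ => (1 + ‖t‖) ^ N)).mul hc.norm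
  refine h4.mono' hc2.aestronglyMeasurable (Filter.Eventually.of_forall fun t => ?_)
  rw [Real.norm_of_nonneg (by positivity)]
  simp only [Function.comp]
  rw [← mul_assoc, ← mul_pow]
  gcongr
  have := hL' t
  nlinarith [norm_nonneg L, norm_nonneg (Matrix.vecMul t A)]

lemma integral_vecMul {r : ℕ} {h : (Fin r → ℝ) → ℂ} (hh : Continuous h)
    {A : Matrix (Fin r) (Fin r) ℝ} (hA : A.det ≠ 0) :
    ∫ t, h (Matrix.vecMul t A) = ((|A.det| : ℝ) : ℂ)⁻¹ * ∫ w, h w := by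
  rw [← integral_map (φ := fun t : Fin r → ℝ => Matrix.vecMul t A)
    (cont_vecMul A).measurable.aemeasurable hh.aestronglyMeasurable, map_vecMul hA,
    integral_smul_measure, ENNReal.toReal_ofReal (abs_nonneg _), abs_inv, Complex.real_smul]
  push_cast; rfl

lemma FT_multi {r : ℕ} {x y : Fin r → ℝ} (hx : ∀ ν, x ν ∈ Set.Ioo (0 : ℝ) 1)
    (hy : ∀ ν, y ν ∈ Set.Ioo (0 : ℝ) 1) (u : Fin r → ℝ) :
    JJ (fun t => FF t x y) u = Complex.I ^ r * eC (-((∑ ν, x ν * y ν : ℝ) : ℂ)) *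
      FF u y (fun ν => 1 - x ν) := by
  unfold JJ FF
  have h1 : ∀ t : Fin r → ℝ, (∏ ν, phiF (t ν) (x ν) (y ν)) *
      Complex.exp (2 * Real.pi * Complex.I * ((∑ μ, t μ * u μ : ℝ) : ℂ)) =
      ∏ ν, (phiF (t ν) (x ν) (y ν) * Complex.exp (2 * Real.pi * Complex.I * (t ν * u ν))) := by
    intro t
    rw [Finset.prod_mul_distrib, ← Complex.exp_sum]
    congr 2
    push_cast
    rw [Finset.mul_sum]
  simp_rw [h1]
  rw [integral_fintype_prod_volume_eq_prod (fun ν (s : ℝ) =>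
    phiF s (x ν) (y ν) * Complex.exp (2 * Real.pi * Complex.I * (s * u ν)))]
  rw [Finset.prod_congr rfl fun ν _ => FT1 (hx ν) (hy ν) (u ν), Finset.prod_mul_distrib,
    Finset.prod_mul_distrib]
  congr 2
  · simp
  · unfold eC
    rw [← Complex.exp_sum]
    congr 1
    push_cast
    rw [← Finset.mul_sum, Finset.sum_neg_distrib]

lemma FT_A {r : ℕ} {x y : Fin r → ℝ} (hx : ∀ ν, x ν ∈ Set.Ioo (0 : ℝ) 1)
    (hy : ∀ ν, y ν ∈ Set.Ioo (0 : ℝ) 1) {A : Matrix (Fin r) (Fin r) ℝ} (hA : A.det ≠ 0)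
    (u : Fin r → ℝ) :
    JJ (fun t => FF (Matrix.vecMul t A) x y) u =
      ((|A.det| : ℝ) : ℂ)⁻¹ * (Complex.I ^ r * eC (-((∑ ν, x ν * y ν : ℝ) : ℂ)) *
      FF (Matrix.vecMul u A.transpose⁻¹) y (fun ν => 1 - x ν)) := by
  rw [← FT_multi hx hy]
  have hc := (FF_RD hx hy).1
  unfold JJ
  rw [← integral_vecMul (h := fun t => FF t x y * Complex.exp (2 * Real.pi * Complex.I *
    ((∑ μ, t μ * Matrix.vecMul u A.transpose⁻¹ μ : ℝ) : ℂ))) (by fun_prop) hA]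
  congr 1
  funext t
  have : ∑ μ, Matrix.vecMul t A μ * Matrix.vecMul u A.transpose⁻¹ μ = ∑ μ, t μ * u μ := by
    change dotProduct (Matrix.vecMul t A) (Matrix.vecMul u A.transpose⁻¹) = dotProduct t u
    rw [← Matrix.transpose_nonsing_inv, Matrix.vecMul_transpose, Matrix.dotProduct_mulVec,
      Matrix.vecMul_vecMul, Matrix.mul_nonsing_inv A (isUnit_iff_ne_zero.2 hA), Matrix.vecMul_one]
  rw [this]

lemma qchar_one {t : ℝ} (ht : t ≠ 0) {k c : ℕ} (hk : 0 < k) (hc : c ≤ 1)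
    (hp : (k : ZMod 2) = (c : ZMod 2)) :
    ((Real.sign t : ℂ)) ^ c * ((|t| : ℝ) : ℂ) ^ (k : ℂ) * ((t : ℂ))⁻¹ = (t : ℂ) ^ (k - 1) := by
  have ht' : (t : ℂ) ≠ 0 := by exact_mod_cast ht
  rw [Complex.cpow_natCast, mul_inv_eq_iff_eq_mul₀ ht', ← pow_succ, Nat.sub_add_cancel hk]
  have hmod : k % 2 = c % 2 := (ZMod.natCast_eq_natCast_iff' k c 2).1 hp
  have hR : Real.sign t ^ c * |t| ^ k = t ^ k := by
    rcases lt_or_gt_of_ne ht with h | h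
    · rw [Real.sign_of_neg h, abs_of_neg h, neg_pow t]
      interval_cases c
      · have : Even k := Nat.even_iff.2 hmod
        simp [this.neg_one_pow]
      · have : Odd k := Nat.odd_iff.2 hmod
        simp [this.neg_one_pow]
    · rw [Real.sign_of_pos h, abs_of_pos h]; simp
  exact_mod_cast hR

theorem stmt_17 (r : ℕ) (hr : 1 ≤ r) (χ : Fin r → ℕ) (hχ : ∀ ν, χ ν ≤ 1)
    (A : Matrix (Fin r) (Fin r) ℝ) (hA : A.det ≠ 0) (x y : Fin r → ℝ)
    (hx : ∀ ν, x ν ∈ Set.Ioo (0 : ℝ) 1) (hy : ∀ ν, y ν ∈ Set.Ioo (0 : ℝ) 1)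
    (k : Fin r → ℕ) (hk : ∀ ν, 0 < k ν)
    (hpar : ∀ ν, (k ν : ZMod 2) = (χ ν : ZMod 2)) :
    ShintaniLchi χ (fun ν => (k ν : ℂ)) A x y =
      ((|A.det| : ℝ) : ℂ)⁻¹ * eC (-((∑ ν, x ν * y ν : ℝ) : ℂ)) *
        BkNum A.transpose⁻¹ y (fun ν => 1 - x ν) (fun ν => k ν - 1) *
        ((2 * (Real.pi : ℂ) * Complex.I) ^ (∑ ν, k ν) /
          (2 ^ r * ∏ ν, (Nat.factorial (k ν - 1) : ℂ))) := by
  have hRD : RD (fun t => FF (Matrix.vecMul t A) x y) := (FF_RD hx hy).comp_vecMul hA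
  set D : ℂ := ((|A.det| : ℝ) : ℂ)⁻¹ with hD
  set E : ℂ := eC (-((∑ ν, x ν * y ν : ℝ) : ℂ)) with hE
  have hD0 : D ≠ 0 := by
    rw [hD]; apply inv_ne_zero; exact_mod_cast abs_ne_zero.2 hA
  have hE0 : E ≠ 0 := Complex.exp_ne_zero _
  have hpi : (Real.pi : ℂ) ≠ 0 := by exact_mod_cast Real.pi_ne_zero
  set C : ℂ := D * (Complex.I ^ r * E) with hC
  have hC0 : C ≠ 0 := mul_ne_zero hD0 (mul_ne_zero (pow_ne_zero _ Complex.I_ne_zero) hE0)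
  set h : (Fin r → ℝ) → ℂ := fun t => C⁻¹ * FF (Matrix.vecMul t A) x y with hh
  have hRDh : RD h := by
    refine ⟨hRD.1.const_mul _ , fun N => ?_⟩
    refine ((hRD.2 N).const_mul ‖C⁻¹‖).congr (Filter.Eventually.of_forall fun t => ?_)
    simp only [hh, norm_mul]; ring
  have hJ : (fun u => FF (Matrix.vecMul u A.transpose⁻¹) y (fun ν => 1 - x ν)) = JJ h := by
    funext u
    have h1 := FT_A hx hy hA u
    have h2 : JJ h u = C⁻¹ * JJ (fun t => FF (Matrix.vecMul t A) x y) u := by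
      unfold JJ
      rw [← integral_const_mul]
      congr 1
      funext t
      simp only [hh]; ring
    rw [h2, h1, ← hD, ← hE]
    have : D * (Complex.I ^ r * E * FF (Matrix.vecMul u A.transpose⁻¹) y (fun ν => 1 - x ν)) =
      C * FF (Matrix.vecMul u A.transpose⁻¹) y (fun ν => 1 - x ν) := by rw [hC]; ring
    rw [this, inv_mul_cancel_left₀ hC0]
  set M : ℂ := ∫ t : Fin r → ℝ, FF (Matrix.vecMul t A) x y * ∏ ν, ((t ν : ℝ) : ℂ) ^ (k ν - 1)
    with hM
  have hB : pderMulti (fun ν => k ν - 1)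
      (fun u => FF (Matrix.vecMul u A.transpose⁻¹) y (fun ν => 1 - x ν)) 0 =
      C⁻¹ * (2 * Real.pi * Complex.I) ^ (∑ ν, (k ν - 1)) * M := by
    rw [hJ, pderMulti_JJ hRDh, hM, ← integral_const_mul]
    congr 1
    funext t
    simp only [hh, mul_pow (2 * Real.pi * Complex.I : ℂ), Finset.prod_mul_distrib,
      Finset.prod_pow_eq_pow_sum]
    ring
  have hL : (∫ t : Fin r → ℝ, FF (Matrix.vecMul t A) x y * qchar χ (fun ν => (k ν : ℂ)) t *
      ∏ ν, ((t ν : ℝ) : ℂ)⁻¹) = M := by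
    rw [hM]
    apply integral_congr_ae
    have hae : ∀ᵐ t : Fin r → ℝ, ∀ ν, t ν ≠ 0 := by
      rw [ae_all_iff]
      intro ν
      exact Measure.ae_eval_ne (μ := fun _ : Fin r => (volume : Measure ℝ)) ν (0 : ℝ)
    filter_upwards [hae] with t ht
    rw [mul_assoc, qchar, ← Finset.prod_mul_distrib]
    congr 1
    exact Finset.prod_congr rfl fun ν _ => qchar_one (ht ν) (hk ν) (hχ ν) (hpar ν)
  have hG : ∏ ν, GammaC ((fun ν => (k ν : ℂ)) ν) =
      2 ^ r * ((2 * Real.pi : ℂ) ^ (∑ ν, k ν))⁻¹ * ∏ ν, (Nat.factorial (k ν - 1) : ℂ) := by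
    have : ∀ ν, GammaC (k ν : ℂ) =
        2 * ((2 * Real.pi : ℂ) ^ (k ν))⁻¹ * (Nat.factorial (k ν - 1) : ℂ) := by
      intro ν
      obtain ⟨m, hm⟩ := Nat.exists_eq_succ_of_ne_zero (hk ν).ne'
      have hg := Complex.Gamma_nat_eq_factorial m
      rw [GammaC, Complex.cpow_neg, Complex.cpow_natCast, hm]
      push_cast
      rw [hg]
    simp only [this]
    rw [Finset.prod_mul_distrib, Finset.prod_mul_distrib, Finset.prod_inv_distrib,
      Finset.prod_pow_eq_pow_sum]
    simp
  have hsum : ∑ ν, k ν = (∑ ν, (k ν - 1)) + r := by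
    have : ∀ ν, k ν = (k ν - 1) + 1 := fun ν => (Nat.sub_add_cancel (hk ν)).symm
    rw [Finset.sum_congr rfl fun ν _ => this ν, Finset.sum_add_distrib]
    simp
  have hP : (∏ ν, (Nat.factorial (k ν - 1) : ℂ)) ≠ 0 :=
    Finset.prod_ne_zero_iff.2 fun ν _ => by exact_mod_cast Nat.factorial_ne_zero _
  rw [ShintaniLchi, hL, hG, BkNum, hB, hC]
  generalize (∏ ν, (Nat.factorial (k ν - 1) : ℂ)) = P at hP
  rw [hsum]
  generalize (∑ ν, (k ν - 1)) = S
  have hI : (Complex.I : ℂ) ≠ 0 := Complex.I_ne_zero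
  have e1 : (-2 * (Real.pi : ℂ)) ^ S = (2 * Real.pi * Complex.I) ^ S * Complex.I ^ S := by
    rw [← mul_pow]; congr 1
    linear_combination (-2 * Real.pi : ℂ) * Complex.I_mul_I
  rw [e1, mul_pow _ Complex.I (S + r), pow_add Complex.I]
  have h2 : (2 * Real.pi * Complex.I : ℂ) ^ S ≠ 0 :=
    pow_ne_zero _ (mul_ne_zero (mul_ne_zero two_ne_zero hpi) hI)
  have h3 : (2 * Real.pi : ℂ) ^ (S + r) ≠ 0 := pow_ne_zero _ (mul_ne_zero two_ne_zero hpi)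
  have h4 : Complex.I ^ S ≠ 0 := pow_ne_zero _ hI
  have h5 : Complex.I ^ r ≠ 0 := pow_ne_zero _ hI
  generalize (2 * Real.pi * Complex.I : ℂ) ^ S = X at *
  generalize (2 * Real.pi : ℂ) ^ (S + r) = Y at *
  generalize Complex.I ^ S = Z at *
  generalize Complex.I ^ r = W at *
  clear_value M D E
  field_simp

end
end
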